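/- arXiv:2511.09718 — 3 statements merged into one kernel-verified Lean document; each statement's English description precedes it below -/
import Mathlib

section
/- There exists a residual subset R of C([0,1]) such that for every f ∈ R: the non-wandering set Ω(f) is a Cantor set of Hausdorff dimension zero, and the physical attractor, the statistical attractor, and the global Milnor attractor of f all coincide with Ω(f), i.e. A_phys(f) = A_stat(f) = Λ(f) = Ω(f). -/
open MeasureTheory Set Filter Topology

noncomputable section

/-- The unit interval `[0,1]` as a subtype of `ℝ`. -/
abbrev I01 : Type := Set.Icc (0:ℝ) 1

/-- Birkhoff average of visits of the orbit of `x` to `U` up to time `n`. -/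
def birkhoffAvg {X : Type*} (f : X → X) (U : Set X) (n : ℕ) (x : X) : ℝ :=
  (∑ k ∈ Finset.range n, U.indicator (fun _ => (1:ℝ)) (f^[k] x)) / n

/-- The ω-limit set of `x` under `f`. -/
def omegaLim {X : Type*} [TopologicalSpace X] (f : X → X) (x : X) : Set X :=
  ⋂ n : ℕ, closure {y | ∃ m, n ≤ m ∧ f^[m] x = y}

/-- The global Milnor attractor: the intersection of all closed sets containing
`ω_f(x)` for `lam`-almost every `x`. -/
def milnorAttr {X : Type*} [TopologicalSpace X] [MeasurableSpace X]
    (lam : Measure X) (f : X → X) : Set X :=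
  ⋂₀ {A : Set X | IsClosed A ∧ ∀ᵐ x ∂lam, omegaLim f x ⊆ A}

/-- The statistical attractor: the complement of the union of all open sets visited
with zero average frequency by almost every orbit. -/
def statAttr {X : Type*} [TopologicalSpace X] [MeasurableSpace X]
    (lam : Measure X) (f : X → X) : Set X :=
  univ \ ⋃₀ {U : Set X | IsOpen U ∧
    ∀ᵐ x ∂lam, Tendsto (fun n => birkhoffAvg f U n x) atTop (nhds 0)}

/-- An open set `U` is essential if for some `ε, δ > 0` and some sequence `k n → ∞`,
the set of points spending average time `> ε` in `U` up to time `k n` has measure `> δ`. -/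
def Essential {X : Type*} [MeasurableSpace X] (lam : Measure X)
    (f : X → X) (U : Set X) : Prop :=
  ∃ ε > (0:ℝ), ∃ δ > (0:ℝ), ∃ k : ℕ → ℕ, Tendsto k atTop atTop ∧
    ∀ n, ENNReal.ofReal δ < lam {x | ε < birkhoffAvg f U (k n) x}

/-- The physical attractor: the complement of the union of all non-essential open sets. -/
def physAttr {X : Type*} [TopologicalSpace X] [MeasurableSpace X]
    (lam : Measure X) (f : X → X) : Set X :=
  univ \ ⋃₀ {U : Set X | IsOpen U ∧ ¬ Essential lam f U}

/-- The non-wandering set of `f`. -/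
def nonWandering {X : Type*} [TopologicalSpace X] (f : X → X) : Set X :=
  {x | ∀ U : Set X, IsOpen U → x ∈ U → ∃ n, 1 ≤ n ∧ ((f^[n] '' U) ∩ U).Nonempty}

/-- A Cantor set: nonempty, compact, perfect and totally disconnected. -/
def IsCantorSet {X : Type*} [TopologicalSpace X] (S : Set X) : Prop :=
  S.Nonempty ∧ IsCompact S ∧ Perfect S ∧ IsTotallyDisconnected S

section Attractors

lemma tendsto_birkhoffAvg_zero {X : Type*} {f : X → X} {U : Set X} {x : X}
    (h : ∀ᶠ n in atTop, f^[n] x ∉ U) :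
    Tendsto (fun n => birkhoffAvg f U n x) atTop (𝓝 0) := by
  have h0 : Tendsto (fun n => U.indicator (fun _ => (1 : ℝ)) (f^[n] x)) atTop (𝓝 0) :=
    tendsto_const_nhds.congr' (h.mono fun n hn => (indicator_of_notMem hn _).symm)
  simpa only [birkhoffAvg, div_eq_inv_mul] using h0.cesaro

lemma essential_of_mapsTo {X : Type*} [MeasurableSpace X] (lam : Measure X) [IsFiniteMeasure lam]
    {f : X → X} {W V : Set X} {n : ℕ} (hn : 1 ≤ n) (hW : lam W ≠ 0) (hWV : W ⊆ V)
    (hf : MapsTo f^[n] W W) : Essential lam f V := by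
  have hn0 : (0 : ℝ) < n := by exact_mod_cast hn
  have hpos : 0 < (lam W).toReal := ENNReal.toReal_pos hW (measure_ne_top _ _)
  refine ⟨1 / (2 * n), by positivity, (lam W).toReal / 2, by positivity, fun m => n * (m + 1),
    ?_, fun m => ?_⟩
  · exact (tendsto_add_atTop_nat 1).const_mul_atTop' hn
  · refine lt_of_lt_of_le (b := lam W) ?_ (measure_mono fun x hx => ?_)
    · rw [ENNReal.ofReal_lt_iff_lt_toReal (by positivity) (measure_ne_top _ _)]
      linarith
    have hsum : ∀ j : ℕ, (j : ℝ) ≤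
        ∑ k ∈ Finset.range (n * j), V.indicator (fun _ => (1 : ℝ)) (f^[k] x) := by
      intro j
      induction j with
      | zero => simp
      | succ j ih =>
        rw [Nat.mul_succ, Finset.sum_range_add, Nat.cast_succ]
        refine add_le_add ih ?_
        have h1 : V.indicator (fun _ => (1 : ℝ)) (f^[n * j + 0] x) = 1 := by
          refine indicator_of_mem (hWV ?_) _
          rw [add_zero, Function.iterate_mul]
          exact hf.iterate j hx
        refine h1.symm.le.trans ?_
        exact Finset.single_le_sum
          (f := fun i => V.indicator (fun _ => (1 : ℝ)) (f^[n * j + i] x))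
          (fun i _ => indicator_nonneg (fun _ _ => zero_le_one) _) (Finset.mem_range.2 hn)
    simp only [mem_ofPred_eq, birkhoffAvg]
    rw [div_lt_div_iff₀ (by positivity) (by positivity)]
    have := hsum (m + 1)
    push_cast at this ⊢
    nlinarith

variable {X : Type*} [TopologicalSpace X]

lemma isClosed_nonWandering (f : X → X) : IsClosed (nonWandering f) := by
  rw [← isOpen_compl_iff, isOpen_iff_forall_mem_open]
  intro x hx
  simp only [nonWandering, mem_compl_iff, mem_ofPred_eq, not_forall] at hx
  obtain ⟨U, hU, hxU, hn⟩ := hx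
  exact ⟨U, fun y hy hyΩ => hn (hyΩ U hU hy), hU, hxU⟩

lemma mem_nonWandering_of_mapClusterPt {f : X → X} {x z : X} {n : ℕ} (hn : 1 ≤ n)
    (hz : MapClusterPt z atTop (fun j => (f^[n])^[j] x)) : z ∈ nonWandering f := by
  intro U hU hzU
  have hfreq := mapClusterPt_iff_frequently.1 hz U (hU.mem_nhds hzU)
  obtain ⟨i, -, hi⟩ := frequently_atTop.1 hfreq 0
  obtain ⟨j, hij, hj⟩ := frequently_atTop.1 hfreq (i + 1)
  obtain ⟨d, rfl⟩ := Nat.exists_eq_add_of_le hij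
  refine ⟨n * (1 + d), Nat.mul_pos hn (by omega), _, ⟨_, hi, rfl⟩, ?_⟩
  rw [Function.iterate_mul, ← Function.iterate_add_apply]
  convert hj using 2
  omega

lemma exists_mem_nonWandering_of_mapsTo {f : X → X} {K : Set X} {n : ℕ} (hn : 1 ≤ n)
    (hK : IsCompact K) (hne : K.Nonempty) (hf : MapsTo f^[n] K K) :
    ∃ z ∈ K, z ∈ nonWandering f := by
  obtain ⟨x, hx⟩ := hne
  obtain ⟨z, hzK, hz⟩ := hK.exists_mapClusterPt (f := atTop) (u := fun j => (f^[n])^[j] x)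
    (tendsto_principal.2 (Eventually.of_forall fun j => hf.iterate j hx))
  exact ⟨z, hzK, mem_nonWandering_of_mapClusterPt hn hz⟩

lemma omegaLim_subset_nonWandering (f : X → X) (x : X) : omegaLim f x ⊆ nonWandering f := by
  intro y hy U hU hyU
  have key : ∀ n, ∃ m, n ≤ m ∧ f^[m] x ∈ U := by
    intro n
    obtain ⟨_, hwU, m, hm, rfl⟩ := mem_closure_iff.1 (mem_iInter.1 hy n) U hU hyU
    exact ⟨m, hm, hwU⟩
  obtain ⟨i, -, hi⟩ := key 0
  obtain ⟨j, hij, hj⟩ := key (i + 1)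
  refine ⟨j - i, by omega, _, ⟨_, hi, rfl⟩, ?_⟩
  rw [← Function.iterate_add_apply]
  convert hj using 2
  omega

lemma milnorAttr_subset_nonWandering [MeasurableSpace X] (lam : Measure X) (f : X → X) :
    milnorAttr lam f ⊆ nonWandering f :=
  sInter_subset_of_mem ⟨isClosed_nonWandering f,
    Eventually.of_forall fun x => omegaLim_subset_nonWandering f x⟩

lemma statAttr_subset_milnorAttr [CompactSpace X] [R1Space X] [MeasurableSpace X]
    (lam : Measure X) (f : X → X) : statAttr lam f ⊆ milnorAttr lam f := by
  rintro y ⟨-, hy⟩ A ⟨hA, hae⟩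
  by_contra hyA
  obtain ⟨C, hC, hCc, hCA⟩ := exists_mem_nhds_isClosed_subset (hA.isOpen_compl.mem_nhds hyA)
  refine hy ⟨interior C, ⟨isOpen_interior, ?_⟩, mem_interior_iff_mem_nhds.2 hC⟩
  filter_upwards [hae] with x hx
  refine tendsto_birkhoffAvg_zero ?_
  by_contra hev
  have hfr : ∃ᶠ n in atTop, f^[n] x ∈ C := by
    rw [Filter.not_eventually] at hev
    exact hev.mono fun n hn => interior_subset (not_not.1 hn)
  obtain ⟨z, hzC, hz⟩ := hCc.isCompact.exists_mapClusterPt_of_frequently hfr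
  refine hCA hzC (hx (mem_iInter.2 fun n => mem_closure_iff_nhds.2 fun V hV => ?_))
  obtain ⟨m, hm, hmV⟩ := frequently_atTop.1 (mapClusterPt_iff_frequently.1 hz V hV) n
  exact ⟨_, hmV, m, hm, rfl⟩

lemma physAttr_subset_statAttr [MeasurableSpace X] [BorelSpace X] (lam : Measure X)
    [IsFiniteMeasure lam] {f : X → X} (hf : Continuous f) : physAttr lam f ⊆ statAttr lam f := by
  refine sdiff_subset_sdiff_right (sUnion_subset_sUnion ?_)
  rintro U ⟨hU, hae⟩
  refine ⟨hU, ?_⟩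
  rintro ⟨ε, hε, δ, hδ, k, hk, hlt⟩
  have hmeas : ∀ n, Measurable (birkhoffAvg f U n) := fun n => by
    unfold birkhoffAvg
    refine Measurable.div_const (Finset.measurable_sum _ fun i _ => ?_) _
    exact (measurable_const.indicator hU.measurableSet).comp (hf.iterate i).measurable
  have htm := tendstoInMeasure_of_tendsto_ae (μ := lam) (f := fun n => birkhoffAvg f U (k n))
    (g := fun _ => 0) (fun n => (hmeas (k n)).aestronglyMeasurable)
    (hae.mono fun x hx => hx.comp hk)
  have h1 := htm (ENNReal.ofReal ε) (by simpa using hε)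
  obtain ⟨n, hn⟩ := (h1.eventually_lt_const (show (0 : ENNReal) < ENNReal.ofReal δ by
    simpa using hδ)).exists
  refine lt_irrefl _ ((hlt n).trans_le ((measure_mono fun x hx => ?_).trans hn.le))
  simp only [mem_ofPred_eq] at hx ⊢
  rw [edist_dist, Real.dist_0_eq_abs]
  exact ENNReal.ofReal_le_ofReal (hx.le.trans (le_abs_self _))

end Attractors

section Perturbation

lemma exists_pos_forall_comp_mem {X : Type*} [PseudoMetricSpace X] [CompactSpace X]
    {f : C(X, X)} {O : Set C(X, X)} (hO : O ∈ 𝓝 f) :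
    ∃ δ > 0, ∀ ψ : C(X, X), (∀ z, dist (ψ z) z < δ) → f.comp ψ ∈ O := by
  have hc := (ContinuousMap.continuous_postcomp (X := X) f).tendsto (ContinuousMap.id X)
  rw [ContinuousMap.comp_id] at hc
  obtain ⟨δ, hδ, h⟩ := Metric.mem_nhds_iff.1 (hc hO)
  exact ⟨δ, hδ, fun ψ hψ => h ((ContinuousMap.dist_lt_iff hδ).2 hψ)⟩

lemma isOpen_setOf_iterate_mapsTo {X : Type*} [TopologicalSpace X] [LocallyCompactSpace X]
    {K O : Set X} (hK : IsCompact K) (hO : IsOpen O) (n : ℕ) :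
    IsOpen {h : C(X, X) | MapsTo h^[n] K O} := by
  have hΦ : ∃ Φ : C(X, X) → C(X, X), Continuous Φ ∧ ∀ h, ⇑(Φ h) = h^[n] := by
    induction n with
    | zero => exact ⟨fun _ => ContinuousMap.id X, continuous_const, fun _ => rfl⟩
    | succ n ih =>
      obtain ⟨Φ, hΦ, h⟩ := ih
      exact ⟨fun g => (Φ g).comp g, hΦ.compCM continuous_id, fun g => by
        rw [ContinuousMap.coe_comp, h, Function.iterate_succ]⟩
  obtain ⟨Φ, hΦ, h⟩ := hΦ
  simpa only [preimage_ofPred_eq, h] using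
    (ContinuousMap.isOpen_setOfPred_mapsTo hK hO).preimage hΦ

lemma iterate_comp_eq {X : Type*} {f ψ : X → X} {U : Set X} {p z : X} {n : ℕ} (hn : 1 ≤ n)
    (hz : ψ z = p) (hψ : ∀ w ∉ U, ψ w = w) (hU : ∀ k, 1 ≤ k → k < n → f^[k] p ∉ U) :
    (f ∘ ψ)^[n] z = f^[n] p := by
  induction n, hn using Nat.le_induction with
  | base => simp [hz]
  | succ n hn ih =>
    rw [Function.iterate_succ_apply', ih fun k h1 h2 => hU k h1 (by omega), Function.comp_apply,
      hψ _ (hU n hn (by omega)), ← Function.iterate_succ_apply' f]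

lemma residual_union_interior_compl {X : Type*} [TopologicalSpace X] {S : Set X} (hS : IsOpen S) :
    S ∪ interior Sᶜ ∈ residual X := by
  refine residual_of_dense_open (hS.union isOpen_interior) ?_
  rw [interior_compl, dense_iff_closure_eq, closure_union, eq_univ_iff_forall]
  intro x
  by_cases hx : x ∈ closure S
  · exact Or.inl hx
  · exact Or.inr (subset_closure hx)

lemma exists_comp_bump (φ : C(I01, I01)) {K O : Set I01} (hK : IsClosed K) (hO : IsOpen O)
    (hKO : K ⊆ O) (p : I01) :
    ∃ ψ : C(I01, I01), (∀ z ∈ K, ψ z = p) ∧ (∀ z ∉ O, ψ z = φ z) ∧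
      ∀ z, dist (ψ z) z ≤ max (dist (φ z) z) (dist p z) := by
  obtain ⟨θ, h0, h1, h01⟩ := exists_continuous_zero_one_of_isClosed hO.isClosed_compl hK
    (disjoint_left.2 fun z hz hzK => hz (hKO hzK))
  have hθ : ∀ z, 0 ≤ 1 - θ z := fun z => sub_nonneg.2 (h01 z).2
  refine ⟨⟨fun z => ⟨(1 - θ z) • (φ z : ℝ) + θ z • (p : ℝ),
    convex_Icc _ _ (φ z).2 p.2 (hθ z) (h01 z).1 (by ring)⟩, by fun_prop⟩, fun z hz => ?_,
    fun z hz => ?_, fun z => ?_⟩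
  · ext
    simp [h1 hz]
  · ext
    simp [h0 hz]
  · exact convex_closedBall (z : ℝ) (max (dist (φ z) z) (dist p z))
      (Metric.mem_closedBall.2 (le_max_left _ _)) (Metric.mem_closedBall.2 (le_max_right _ _))
      (hθ z) (h01 z).1 (by ring)

/-- Maps with two disjoint absorbing intervals of a common period inside `V`. -/
def doubleTrap (V : Set I01) : Set C(I01, I01) :=
  {h | ∃ (a b : I01) (s : ℝ) (n : ℕ), 0 < s ∧ 1 ≤ n ∧ Metric.closedBall a s ⊆ V ∧
    Metric.closedBall b s ⊆ V ∧ Disjoint (Metric.closedBall a s) (Metric.closedBall b s) ∧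
    MapsTo h^[n] (Metric.closedBall a s) (Metric.ball a s) ∧
    MapsTo h^[n] (Metric.closedBall b s) (Metric.ball b s)}

lemma isOpen_doubleTrap (V : Set I01) : IsOpen (doubleTrap V) := by
  rw [isOpen_iff_mem_nhds]
  rintro h ⟨a, b, s, n, hs, hn, ha, hb, hd, hta, htb⟩
  filter_upwards [(isOpen_setOf_iterate_mapsTo (isCompact_closedBall a s) Metric.isOpen_ball
    n).mem_nhds hta, (isOpen_setOf_iterate_mapsTo (isCompact_closedBall b s) Metric.isOpen_ball
    n).mem_nhds htb] with g hga hgb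
  exact ⟨a, b, s, n, hs, hn, ha, hb, hd, hga, hgb⟩

/-- Maps that are not constant on any nonempty open set. -/
def NowhereConstant (f : I01 → I01) : Prop :=
  ∀ V : Set I01, IsOpen V → V.Nonempty → ∃ p ∈ V, ∃ q ∈ V, f p ≠ f q

lemma NowhereConstant.interior_image_nonempty {f : I01 → I01} (h : NowhereConstant f)
    (hf : Continuous f) {V : Set I01} (hV : IsOpen V) (hne : V.Nonempty) :
    (interior (f '' V)).Nonempty := by
  obtain ⟨a, b, hab, hsub⟩ := hV.exists_Ioo_subset hne
  obtain ⟨p, hp, q, hq, hpq⟩ := h (Ioo a b) isOpen_Ioo (nonempty_Ioo.2 hab)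
  have hconn : IsPreconnected (Ioo a b) := by
    rw [← Topology.IsInducing.subtypeVal.isPreconnected_image]
    have : ((↑) : I01 → ℝ) '' Ioo a b = Ioo (a : ℝ) b := by
      ext x
      constructor
      · rintro ⟨y, hy, rfl⟩
        exact hy
      · intro hx
        exact ⟨⟨x, a.2.1.trans hx.1.le, hx.2.le.trans b.2.2⟩, hx, rfl⟩
    rw [this]
    exact isPreconnected_Ioo
  have himg := hconn.image f hf.continuousOn
  wlog hlt : f p < f q generalizing p q
  · exact this q hq p hp hpq.symm (lt_of_le_of_ne (not_lt.1 hlt) hpq.symm)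
  have hIcc := himg.Icc_subset (mem_image_of_mem f hp) (mem_image_of_mem f hq)
  exact (nonempty_Ioo.2 hlt).mono (interior_maximal
    (Ioo_subset_Icc_self.trans (hIcc.trans (image_mono hsub))) isOpen_Ioo)

lemma NowhereConstant.interior_iterate_image_nonempty {f : I01 → I01} (h : NowhereConstant f)
    (hf : Continuous f) {V : Set I01} (hV : IsOpen V) (hne : V.Nonempty) (n : ℕ) :
    (interior (f^[n] '' V)).Nonempty := by
  induction n with
  | zero => simpa [hV.interior_eq] using hne
  | succ n ih =>
    refine (h.interior_image_nonempty hf isOpen_interior ih).mono (interior_mono ?_)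
    rw [Function.iterate_succ', image_comp]
    exact image_mono interior_subset

lemma exists_comp_mem_doubleTrap {f : C(I01, I01)} (hf : NowhereConstant f) {V : Set I01}
    (hV : IsOpen V) {y : I01} (hyV : y ∈ V) (hy : y ∈ nonWandering f) {δ : ℝ} (hδ : 0 < δ) :
    ∃ ψ : C(I01, I01), (∀ z, dist (ψ z) z < δ) ∧ f.comp ψ ∈ doubleTrap V := by
  classical
  obtain ⟨r, hr, hrV⟩ := Metric.isOpen_iff.1 hV y hyV
  set U := Metric.ball y (min r (δ / 2)) with hUdef
  have hUV : U ⊆ V := (Metric.ball_subset_ball (min_le_left _ _)).trans hrV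
  have hU : IsOpen U := Metric.isOpen_ball
  have hUδ : ∀ p ∈ U, ∀ z ∈ U, dist p z < δ := fun p hp z hz => by
    have h1 := (Metric.mem_ball.1 hp).trans_le (min_le_right _ _)
    have h2 := (Metric.mem_ball'.1 hz).trans_le (min_le_right _ _)
    linarith [dist_triangle p y z]
  have hex := hy U hU (Metric.mem_ball_self (lt_min hr (by positivity)))
  set n := Nat.find hex with hn_def
  obtain ⟨hn, _, ⟨x, hx, rfl⟩, hxU⟩ := Nat.find_spec hex
  have hmin : ∀ p ∈ U, ∀ k, 1 ≤ k → k < n → f^[k] p ∉ U := fun p hp k h1 hk hpk =>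
    Nat.find_min hex hk ⟨h1, _, mem_image_of_mem _ hp, hpk⟩
  obtain ⟨a, ha⟩ := hf.interior_iterate_image_nonempty f.continuous
    (hU.inter (hU.preimage (f.continuous.iterate n))) ⟨x, hx, hxU⟩ n
  obtain ⟨b, hb, hba⟩ := (infinite_of_mem_nhds a (isOpen_interior.mem_nhds ha)).nontrivial.exists_ne
    a
  obtain ⟨p, ⟨hpU, hpa⟩, rfl⟩ := interior_subset ha
  obtain ⟨q, ⟨hqU, hqb⟩, rfl⟩ := interior_subset hb
  set a := f^[n] p
  set b := f^[n] q
  have hsmall : ∀ᶠ s : ℝ in 𝓝[>] 0, Metric.closedBall a s ⊆ U ∧ Metric.closedBall b s ⊆ U ∧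
      s + s < dist a b := by
    refine Filter.Eventually.filter_mono nhdsWithin_le_nhds ?_
    refine (eventually_closedBall_subset (hU.mem_nhds hpa)).and
      ((eventually_closedBall_subset (hU.mem_nhds hqb)).and ?_)
    have : Tendsto (fun s : ℝ => s + s) (𝓝 0) (𝓝 0) := by
      simpa using (tendsto_id (x := 𝓝 (0 : ℝ))).add tendsto_id
    exact this.eventually_lt_const (dist_pos.2 hba.symm)
  obtain ⟨s, ⟨hsa, hsb, hsab⟩, hs⟩ := (hsmall.and self_mem_nhdsWithin).exists
  have hs : 0 < s := hs
  have hdisj : Disjoint (Metric.closedBall a s) (Metric.closedBall b s) :=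
    Metric.closedBall_disjoint_closedBall hsab
  obtain ⟨ψ₁, h1K, h1O, h1d⟩ := exists_comp_bump (ContinuousMap.id _)
    (Metric.isClosed_closedBall (x := a) (ε := s))
    (hU.sdiff (Metric.isClosed_closedBall (x := b) (ε := s)))
    (fun z hz => ⟨hsa hz, disjoint_left.1 hdisj hz⟩) p
  obtain ⟨ψ, hK, hO, hd⟩ := exists_comp_bump ψ₁
    (Metric.isClosed_closedBall (x := b) (ε := s))
    (hU.sdiff (Metric.isClosed_closedBall (x := a) (ε := s)))
    (fun z hz => ⟨hsb hz, disjoint_right.1 hdisj hz⟩) q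
  have hid : ∀ z ∉ U, ψ z = z := fun z hz => by
    rw [hO z fun h => hz h.1, h1O z fun h => hz h.1, ContinuousMap.id_apply]
  have hψa : ∀ z ∈ Metric.closedBall a s, ψ z = p := fun z hz => by
    rw [hO z fun h => h.2 hz, h1K z hz]
  refine ⟨ψ, fun z => ?_, a, b, s, n, hs, hn, hsa.trans hUV, hsb.trans hUV, hdisj, ?_, ?_⟩
  · by_cases hz : z ∈ U
    · refine (hd z).trans_lt (max_lt ((h1d z).trans_lt (max_lt ?_ (hUδ p hpU z hz)))
        (hUδ q hqU z hz))
      simpa using hδ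
    · rw [hid z hz, dist_self]
      exact hδ
  · intro z hz
    rw [ContinuousMap.coe_comp, iterate_comp_eq hn (hψa z hz) hid (hmin p hpU)]
    exact Metric.mem_ball_self hs
  · intro z hz
    rw [ContinuousMap.coe_comp, iterate_comp_eq hn (hK z hz) hid (hmin q hqU)]
    exact Metric.mem_ball_self hs

lemma residual_not_constant_on {V : Set I01} (hV : IsOpen V) (hne : V.Nonempty) :
    {f : C(I01, I01) | ∃ p ∈ V, ∃ q ∈ V, f p ≠ f q} ∈ residual C(I01, I01) := by
  refine residual_of_dense_open ?_ ?_
  · have : {f : C(I01, I01) | ∃ p ∈ V, ∃ q ∈ V, f p ≠ f q} =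
        ⋃ p ∈ V, ⋃ q ∈ V, {f : C(I01, I01) | f p ≠ f q} := by
      ext
      simp only [mem_ofPred_eq, mem_iUnion, exists_prop]
    rw [this]
    exact isOpen_biUnion fun p _ => isOpen_biUnion fun q _ =>
      isOpen_ne_fun (continuous_eval_const p) (continuous_eval_const q)
  · rw [Metric.dense_iff]
    intro f ε hε
    by_cases hf : ∃ p ∈ V, ∃ q ∈ V, f p ≠ f q
    · exact ⟨f, Metric.mem_ball_self hε, hf⟩
    push Not at hf
    obtain ⟨p, hp⟩ := hne
    obtain ⟨q, hq, hqp⟩ := (infinite_of_mem_nhds p (hV.mem_nhds hp)).nontrivial.exists_ne p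
    obtain ⟨c, hc0, hc⟩ := exists_between (lt_min hε one_pos)
    have hc1 : 0 ≤ 1 - c := sub_nonneg.2 (hc.le.trans (min_le_right _ _))
    refine ⟨⟨fun z => ⟨(1 - c) • (f z : ℝ) + c • (z : ℝ),
      convex_Icc _ _ (f z).2 z.2 hc1 hc0.le (by ring)⟩, by fun_prop⟩, ?_, p, hp, q, hq, ?_⟩
    · rw [Metric.mem_ball, ContinuousMap.dist_lt_iff hε]
      intro z
      rw [Subtype.dist_eq, Real.dist_eq]
      have : (1 - c) • (f z : ℝ) + c • (z : ℝ) - f z = c * (z - f z) := by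
        simp only [smul_eq_mul]
        ring
      simp only [ContinuousMap.coe_mk, this, abs_mul, abs_of_pos hc0]
      have hz : |(z : ℝ) - f z| ≤ 1 := abs_le.2
        ⟨by linarith [z.2.1, (f z).2.2], by linarith [z.2.2, (f z).2.1]⟩
      nlinarith [hc.trans_le (min_le_left ε 1)]
    · intro h
      have h' := congrArg Subtype.val h
      simp only [ContinuousMap.coe_mk, hf p hp q hq, smul_eq_mul, add_right_inj] at h'
      exact hqp (Subtype.ext (mul_left_cancel₀ hc0.ne' h').symm)

end Perturbation

section Dimension

/-- A continuous staircase that takes integer values away from the `ρ`-neighbourhoods of the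
points `j + τ`, `j ∈ ℤ`. -/
lemma exists_staircase {τ ρ : ℝ} (hρ : 0 < ρ) (hτ : ρ ≤ τ) (hτ' : ρ ≤ 1 - τ) :
    ∃ σ : ℝ → ℝ, Continuous σ ∧ (∀ u, (⌊u⌋ : ℝ) ≤ σ u ∧ σ u ≤ ⌈u⌉) ∧
      ∀ u, ρ ≤ |Int.fract u - τ| → ∃ i : ℤ, σ u = i := by
  set c : ℝ → ℝ := fun v => max 0 (min 1 ((v - τ) / (2 * ρ) + 1 / 2)) with hc
  have hlo : ∀ v, v ≤ τ - ρ → c v = 0 := fun v hv => by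
    have : (v - τ) / (2 * ρ) ≤ -(1 / 2) := by
      rw [div_le_iff₀ (by positivity)]
      linarith
    exact max_eq_left ((min_le_right _ _).trans (by linarith))
  have hhi : ∀ v, τ + ρ ≤ v → c v = 1 := fun v hv => by
    have : 1 / 2 ≤ (v - τ) / (2 * ρ) := by
      rw [le_div_iff₀ (by positivity)]
      linarith
    simp only [hc]
    rw [min_eq_left (by linarith), max_eq_right zero_le_one]
  have hσ : ∀ u : ℝ, u + (c (Int.fract u) - Int.fract u) = ⌊u⌋ + c (Int.fract u) := fun u => by
    linarith [Int.floor_add_fract u]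
  refine ⟨fun u => u + (c (Int.fract u) - Int.fract u), ?_, fun u => ?_, fun u hu => ?_⟩
  · refine continuous_id.add (ContinuousOn.comp_fract'' (f := fun v => c v - v) ?_ ?_)
    · exact Continuous.continuousOn (by fun_prop)
    · rw [hlo 0 (by linarith), hhi 1 (by linarith)]
      norm_num
  · simp only [hσ]
    have hc0 : 0 ≤ c (Int.fract u) := le_max_left _ _
    refine ⟨by linarith, ?_⟩
    have hc1 : c (Int.fract u) ≤ 1 := max_le zero_le_one (min_le_left _ _)
    rcases (Int.fract_nonneg u).eq_or_lt with h | h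
    · rw [← h, hlo 0 (by linarith), add_zero]
      exact_mod_cast Int.floor_le_ceil u
    · have : ⌊u⌋ + 1 ≤ ⌈u⌉ := by
        rw [Int.add_one_le_iff, Int.lt_ceil]
        linarith [Int.floor_add_fract u]
      have : ((⌊u⌋ + 1 : ℤ) : ℝ) ≤ ⌈u⌉ := by exact_mod_cast this
      push_cast at this
      linarith
  · simp only [hσ]
    rcases le_abs.1 hu with h | h
    · exact ⟨⌊u⌋ + 1, by rw [hhi _ (by linarith)]; push_cast; ring⟩
    · exact ⟨⌊u⌋, by rw [hlo _ (by linarith), add_zero]⟩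

/-- Maps sending everything outside the `r`-neighbourhood of a finite set `T` into the
`r`-neighbourhood of a finite set `F`, where `r` is very small compared with `m` and with the
cardinalities of `T` and `F`. -/
def thinMaps (m : ℕ) : Set C(I01, I01) :=
  {h | ∃ (T F : Finset I01) (r : ℝ), 0 < r ∧ 2 * r ≤ 1 / (m + 1 : ℝ) ∧
    (T.card + F.card : ℝ) * (2 * r) ^ (1 / (m + 1 : ℝ)) ≤ 1 / (m + 1 : ℝ) ∧
    (∀ t ∈ T, ∀ p ∈ F, 2 * r ≤ dist t p) ∧
    MapsTo h {z | ∀ t ∈ T, r ≤ dist z t} (⋃ p ∈ F, Metric.ball p r)}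

lemma isOpen_thinMaps (m : ℕ) : IsOpen (thinMaps m) := by
  rw [isOpen_iff_mem_nhds]
  rintro h ⟨T, F, r, hr, hrm, hcard, hTF, hmaps⟩
  have hclosed : IsClosed {z : I01 | ∀ t ∈ T, r ≤ dist z t} := by
    simp only [ofPred_forall]
    exact isClosed_biInter fun t _ => isClosed_le continuous_const (by fun_prop)
  filter_upwards [(ContinuousMap.isOpen_setOfPred_mapsTo hclosed.isCompact
    (isOpen_biUnion fun p (_ : p ∈ F) => Metric.isOpen_ball)).mem_nhds hmaps] with g hg
  exact ⟨T, F, r, hr, hrm, hcard, hTF, hg⟩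

lemma exists_comp_mem_thinMaps (f : C(I01, I01)) (m : ℕ) {δ : ℝ} (hδ : 0 < δ) :
    ∃ ψ : C(I01, I01), (∀ z, dist (ψ z) z < δ) ∧ f.comp ψ ∈ thinMaps m := by
  classical
  obtain ⟨k, hk⟩ := exists_nat_one_div_lt hδ
  set N : ℕ := k + 1 with hNdef
  have hN : (0 : ℝ) < N := by positivity
  have hNδ : 1 / (N : ℝ) < δ := by simpa [hNdef] using hk
  have hmem : ∀ x : ℝ, 0 ≤ x → x ≤ N → x / N ∈ Icc (0 : ℝ) 1 := fun x h0 h1 =>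
    ⟨by positivity, (div_le_one hN).2 h1⟩
  set F : Finset I01 := (Finset.range (N + 1)).image
    fun i : ℕ => f (projIcc 0 1 zero_le_one ((i : ℝ) / N)) with hF
  obtain ⟨τ, ⟨hτ0, hτ1⟩, hτF⟩ : ∃ τ ∈ Ioo (0 : ℝ) 1,
      τ ∉ F.image fun p : I01 => Int.fract (N * (p : ℝ)) :=
    (Ioo_infinite zero_lt_one).exists_notMem_finset _
  set T : Finset I01 := (Finset.range N).image
    fun j : ℕ => projIcc 0 1 zero_le_one (((j : ℝ) + τ) / N) with hT
  have hTval : ∀ j : ℕ, j < N →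
      ((projIcc (0 : ℝ) 1 zero_le_one (((j : ℝ) + τ) / N) : I01) : ℝ) = (j + τ) / N := by
    intro j hj
    have : (j : ℝ) + 1 ≤ N := by exact_mod_cast hj
    rw [projIcc_of_mem _ (hmem _ (by positivity) (by linarith))]
  have hTF : ∀ t ∈ T, ∀ p ∈ F, t ≠ p := by
    rintro t ht p hp rfl
    obtain ⟨j, hj, rfl⟩ := Finset.mem_image.1 ht
    refine hτF (Finset.mem_image.2 ⟨_, hp, ?_⟩)
    rw [hTval j (Finset.mem_range.1 hj), mul_div_cancel₀ _ hN.ne', Int.fract_natCast_add]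
    exact Int.fract_eq_self.2 ⟨hτ0.le, hτ1⟩
  have hm : (0 : ℝ) < 1 / (m + 1 : ℝ) := by positivity
  have hlin : ∀ a : ℝ, Tendsto (fun r : ℝ => a * r) (𝓝 0) (𝓝 0) := fun a => by
    simpa using (tendsto_id (x := 𝓝 (0 : ℝ))).const_mul a
  have hpow : Tendsto (fun r : ℝ => (T.card + F.card : ℝ) * (2 * r) ^ (1 / (m + 1 : ℝ)))
      (𝓝 0) (𝓝 0) := by
    have h := ((hlin 2).rpow_const (p := 1 / (m + 1 : ℝ)) (Or.inr hm.le)).const_mul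
      (T.card + F.card : ℝ)
    rwa [Real.zero_rpow hm.ne', mul_zero] at h
  have hev : ∀ᶠ r : ℝ in 𝓝 0, 2 * r ≤ 1 / (m + 1 : ℝ) ∧
      (T.card + F.card : ℝ) * (2 * r) ^ (1 / (m + 1 : ℝ)) ≤ 1 / (m + 1 : ℝ) ∧
      (∀ t ∈ T, ∀ p ∈ F, 2 * r ≤ dist t p) ∧ N * r ≤ τ ∧ N * r ≤ 1 - τ := by
    refine ((hlin 2).eventually_le_const hm).and ((hpow.eventually_le_const hm).and
      (Filter.Eventually.and ?_ (((hlin N).eventually_le_const hτ0).and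
        ((hlin N).eventually_le_const (sub_pos.2 hτ1)))))
    simp only [Finset.eventually_all]
    exact fun t ht p hp => (hlin 2).eventually_le_const (dist_pos.2 (hTF t ht p hp))
  obtain ⟨r, ⟨hrm, hcard, hdist, hτr, hτr'⟩, hr⟩ :=
    ((hev.filter_mono nhdsWithin_le_nhds).and (self_mem_nhdsWithin (s := Ioi 0))).exists
  have hr : 0 < r := hr
  obtain ⟨σ, hσc, hσb, hσi⟩ := exists_staircase (mul_pos hN hr) hτr hτr'
  have hσ0 : ∀ z : I01, 0 ≤ σ (N * z) := fun z =>
    le_trans (by exact_mod_cast Int.floor_nonneg.2 (mul_nonneg hN.le z.2.1)) (hσb _).1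
  have hσN : ∀ z : I01, σ (N * z) ≤ N := fun z => by
    refine (hσb _).2.trans ?_
    have : ⌈(N : ℝ) * z⌉ ≤ (N : ℤ) := Int.ceil_le.2 (by
      push_cast
      nlinarith [z.2.2])
    exact_mod_cast this
  refine ⟨⟨fun z => ⟨σ (N * z) / N, hmem _ (hσ0 z) (hσN z)⟩, by fun_prop⟩, fun z => ?_, T, F, r,
    hr, hrm, hcard, hdist, fun z hz => ?_⟩
  · refine lt_of_le_of_lt ?_ hNδ
    rw [Subtype.dist_eq, Real.dist_eq]
    have h1 : σ (N * z) / N - z = (σ (N * z) - N * z) / N := by field_simp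
    simp only [ContinuousMap.coe_mk, h1]
    rw [abs_div, abs_of_pos hN]
    gcongr
    have h2 := hσb (N * z)
    exact abs_le.2 ⟨by linarith [Int.lt_floor_add_one ((N : ℝ) * z)],
      by linarith [Int.ceil_lt_add_one ((N : ℝ) * z)]⟩
  · have hfr : N * r ≤ |Int.fract ((N : ℝ) * z) - τ| := by
      rcases z.2.2.eq_or_lt with h1 | h1
      · rw [h1, mul_one, Int.fract_natCast, zero_sub, abs_neg, abs_of_pos hτ0]
        exact hτr
      · obtain ⟨j, hj⟩ := Int.eq_ofNat_of_zero_le (Int.floor_nonneg.2 (mul_nonneg hN.le z.2.1))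
        have hjN : j < N := by
          have : ⌊(N : ℝ) * z⌋ < (N : ℤ) := Int.floor_lt.2 (by
            push_cast
            nlinarith)
          rw [hj] at this
          exact_mod_cast this
        have hd := hz _ (Finset.mem_image_of_mem _ (Finset.mem_range.2 hjN))
        rw [Subtype.dist_eq, Real.dist_eq, hTval j hjN] at hd
        have h2 : Int.fract ((N : ℝ) * z) - τ = N * (z - (j + τ) / N) := by
          have h3 := Int.floor_add_fract ((N : ℝ) * z)
          rw [hj] at h3
          push_cast at h3
          field_simp
          linarith
        rw [h2, abs_mul, abs_of_pos hN]
        gcongr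
    obtain ⟨i, hi⟩ := hσi _ hfr
    have hi0 : 0 ≤ i := by exact_mod_cast hi ▸ hσ0 z
    obtain ⟨i, rfl⟩ := Int.eq_ofNat_of_zero_le hi0
    have hiN : i < N + 1 := by
      have := hi ▸ hσN z
      exact Nat.lt_succ_of_le (by exact_mod_cast this)
    refine mem_iUnion₂.2 ⟨_, Finset.mem_image_of_mem _ (Finset.mem_range.2 hiN), ?_⟩
    have : (⟨σ (N * z) / N, hmem _ (hσ0 z) (hσN z)⟩ : I01) =
        projIcc 0 1 zero_le_one ((i : ℝ) / N) := by
      have hi' : σ (N * z) = (i : ℝ) := by exact_mod_cast hi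
      rw [projIcc_of_mem _ (hi' ▸ hmem _ (hσ0 z) (hσN z))]
      exact Subtype.ext (congrArg (· / (N : ℝ)) hi')
    simp only [ContinuousMap.comp_apply, ContinuousMap.coe_mk, this]
    exact Metric.mem_ball_self hr

lemma residual_thinMaps (m : ℕ) : thinMaps m ∈ residual C(I01, I01) := by
  refine residual_of_dense_open (isOpen_thinMaps m) fun f => ?_
  rw [mem_closure_iff_nhds]
  intro O hO
  obtain ⟨δ, hδ, h⟩ := exists_pos_forall_comp_mem hO
  obtain ⟨ψ, hψ, hthin⟩ := exists_comp_mem_thinMaps f m hδ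
  exact ⟨_, h ψ hψ, hthin⟩

lemma nonWandering_subset_of_mapsTo {X : Type*} [PseudoMetricSpace X] {h : X → X}
    {T F : Finset X} {r : ℝ} (hTF : ∀ t ∈ T, ∀ p ∈ F, 2 * r ≤ dist t p)
    (hmaps : MapsTo h {z | ∀ t ∈ T, r ≤ dist z t} (⋃ p ∈ F, Metric.ball p r)) :
    nonWandering h ⊆ ⋃ c : T ⊕ F, Metric.closedBall (Sum.elim Subtype.val Subtype.val c) r := by
  intro y hy
  by_contra hcov
  simp only [mem_iUnion, Metric.mem_closedBall, not_exists, not_le, Sum.forall, Sum.elim_inl,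
    Sum.elim_inr, Subtype.forall] at hcov
  set U : Set X := (⋂ t ∈ T, {z | r < dist z t}) ∩ ⋂ p ∈ F, {z | r < dist z p} with hUdef
  have hopen : ∀ S : Finset X, IsOpen (⋂ t ∈ S, {z | r < dist z t}) := fun S =>
    isOpen_biInter_finset fun t _ => isOpen_lt continuous_const (by fun_prop)
  obtain ⟨n, hn, w, ⟨x, hxU, rfl⟩, hwU⟩ := hy U ((hopen T).inter (hopen F))
    ⟨mem_iInter₂.2 hcov.1, mem_iInter₂.2 hcov.2⟩
  have hOO : MapsTo h (⋃ p ∈ F, Metric.ball p r) (⋃ p ∈ F, Metric.ball p r) := by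
    refine hmaps.mono_left fun z hz t ht => ?_
    obtain ⟨p, hp, hzp⟩ := mem_iUnion₂.1 hz
    rw [Metric.mem_ball] at hzp
    linarith [hTF t ht p hp, dist_triangle t z p, dist_comm z t]
  obtain ⟨n, rfl⟩ := Nat.exists_eq_add_of_le' hn
  have hxO : h x ∈ ⋃ p ∈ F, Metric.ball p r :=
    hmaps fun t ht => (mem_iInter₂.1 hxU.1 t ht).le
  have hwO := hOO.iterate n hxO
  rw [← Function.iterate_succ_apply] at hwO
  obtain ⟨p, hp, hwp⟩ := mem_iUnion₂.1 hwO
  exact lt_asymm (Metric.mem_ball.1 hwp) (mem_iInter₂.1 hwU.2 p hp)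

lemma dimH_eq_zero_of_forall_cover {X : Type*} [MetricSpace X] {S : Set X} {ι : ℕ → Type*}
    [∀ m, Fintype (ι m)] (x : ∀ m, ι m → X) {r : ℕ → ℝ} (hr : ∀ m, 0 < r m)
    (hrm : ∀ m, 2 * r m ≤ 1 / (m + 1 : ℝ))
    (hcard : ∀ m, (Fintype.card (ι m) : ℝ) * (2 * r m) ^ (1 / (m + 1 : ℝ)) ≤ 1 / (m + 1 : ℝ))
    (hcov : ∀ m, S ⊆ ⋃ c, Metric.closedBall (x m c) (r m)) : dimH S = 0 := by
  borelize X
  refine le_antisymm (dimH_le fun d hd => ?_) bot_le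
  by_contra hd0
  have hd0 : 0 < (d : ℝ) := by
    rw [not_le] at hd0
    exact_mod_cast hd0
  have hlim : Tendsto (fun m : ℕ => ENNReal.ofReal (1 / (m + 1 : ℝ))) atTop (𝓝 0) := by
    simpa using ENNReal.tendsto_ofReal tendsto_one_div_add_atTop_nhds_zero_nat
  have hdiam : ∀ m (c : X), Metric.ediam (Metric.closedBall c (r m)) ≤
      ENNReal.ofReal (2 * r m) := fun m c => by
    rw [← Metric.closedEBall_ofReal (hr m).le]
    refine Metric.ediam_closedEBall_le.trans_eq ?_
    rw [ENNReal.ofReal_mul zero_le_two, ENNReal.ofReal_ofNat]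
  have hle := Measure.hausdorffMeasure_le_liminf_sum (d : ℝ) S (l := atTop)
    (fun m : ℕ => ENNReal.ofReal (1 / (m + 1 : ℝ))) hlim
    (fun m c => Metric.closedBall (x m c) (r m))
    (Eventually.of_forall fun m c => (hdiam m _).trans (ENNReal.ofReal_le_ofReal (hrm m)))
    (Eventually.of_forall hcov)
  refine ENNReal.top_ne_zero (hd.symm.trans (le_antisymm (hle.trans_eq (Tendsto.liminf_eq ?_))
    bot_le))
  refine tendsto_of_tendsto_of_tendsto_of_le_of_le' tendsto_const_nhds hlim
    (Eventually.of_forall fun _ => bot_le) ?_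
  filter_upwards [tendsto_one_div_add_atTop_nhds_zero_nat.eventually_le_const hd0] with m hm
  have h1 : 2 * r m ≤ 1 := (hrm m).trans (by
    rw [div_le_one (by positivity)]
    linarith [m.cast_nonneg (α := ℝ)])
  calc ∑ c, Metric.ediam (Metric.closedBall (x m c) (r m)) ^ (d : ℝ)
      ≤ ∑ _c : ι m, ENNReal.ofReal ((2 * r m) ^ (1 / (m + 1 : ℝ))) := by
        refine Finset.sum_le_sum fun c _ => ?_
        refine (ENNReal.rpow_le_rpow (hdiam m _) hd0.le).trans ?_
        rw [ENNReal.ofReal_rpow_of_pos (by linarith [hr m])]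
        exact ENNReal.ofReal_le_ofReal
          (Real.rpow_le_rpow_of_exponent_ge (by linarith [hr m]) h1 hm)
    _ = ENNReal.ofReal (Fintype.card (ι m)) *
          ENNReal.ofReal ((2 * r m) ^ (1 / (m + 1 : ℝ))) := by
        rw [Finset.sum_const, nsmul_eq_mul, Finset.card_univ, ENNReal.ofReal_natCast]
    _ ≤ ENNReal.ofReal (1 / (m + 1 : ℝ)) := by
        rw [← ENNReal.ofReal_mul (by positivity)]
        exact ENNReal.ofReal_le_ofReal (hcard m)

lemma dimH_nonWandering_eq_zero {f : C(I01, I01)} (hf : ∀ m, f ∈ thinMaps m) :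
    dimH (nonWandering f) = 0 := by
  choose T F r hr hrm hcard hTF hmaps using hf
  refine dimH_eq_zero_of_forall_cover (ι := fun m => T m ⊕ F m)
    (fun m => Sum.elim Subtype.val Subtype.val) hr hrm (fun m => ?_)
    fun m => nonWandering_subset_of_mapsTo (hTF m) (hmaps m)
  rw [Fintype.card_sum, Fintype.card_coe, Fintype.card_coe, Nat.cast_add]
  exact hcard m

lemma isTotallyDisconnected_of_dimH_lt_one {S : Set I01} (hS : dimH S < 1) :
    IsTotallyDisconnected S := by
  intro t htS ht
  by_contra hsub
  rw [not_subsingleton_iff] at hsub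
  obtain ⟨a, ha, b, hb, hab⟩ := hsub.exists_lt
  have hIcc : Icc (a : ℝ) b ⊆ (↑) '' S := fun x hx =>
    ⟨⟨x, a.2.1.trans hx.1, hx.2.trans b.2.2⟩, htS (ht.Icc_subset ha hb hx), rfl⟩
  have h1 : dimH (Icc (a : ℝ) b) = 1 := by
    rw [Real.dimH_of_nonempty_interior (by simpa using hab)]
    simp
  exact (h1.symm.trans_le ((dimH_mono hIcc).trans_eq (isometry_subtype_coe.dimH_image S))).not_gt
    hS

end Dimension

instance isOpenPosMeasure_I01 : (volume : Measure I01).IsOpenPosMeasure := by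
  refine ⟨fun U hU hne => ?_⟩
  obtain ⟨a, b, hab, hsub⟩ := hU.exists_Ioo_subset hne
  have himg : Ioo (a : ℝ) b ⊆ (↑) '' U := fun x hx =>
    ⟨⟨x, a.2.1.trans hx.1.le, hx.2.le.trans b.2.2⟩, hsub hx, rfl⟩
  rw [Measure.Subtype.volume_def, comap_subtype_coe_apply measurableSet_Icc]
  exact ne_of_gt (lt_of_lt_of_le (by simpa using hab) (measure_mono himg))

/-- there is a residual subset `R` of `C([0,1])` such that for every
`f ∈ R`, the non-wandering set `Ω(f)` is a Cantor set of Hausdorff dimension zero and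
`A_phys(f) = A_stat(f) = Λ(f) = Ω(f)`. -/
theorem stmt0 :
    ∃ R ∈ residual C(I01, I01), ∀ f ∈ R,
      IsCantorSet (nonWandering ⇑f) ∧
      dimH (nonWandering ⇑f) = 0 ∧
      physAttr (volume : Measure I01) ⇑f = nonWandering ⇑f ∧
      statAttr (volume : Measure I01) ⇑f = nonWandering ⇑f ∧
      milnorAttr (volume : Measure I01) ⇑f = nonWandering ⇑f := by
  obtain ⟨B, hBc, hB0, hB⟩ := TopologicalSpace.exists_countable_basis I01
  refine ⟨(⋂ V ∈ B, doubleTrap V ∪ interior (doubleTrap V)ᶜ) ∩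
    (⋂ V ∈ B, {f : C(I01, I01) | ∃ p ∈ V, ∃ q ∈ V, f p ≠ f q}) ∩ ⋂ m, thinMaps m,
    inter_mem (inter_mem ?_ ?_) (countable_iInter_mem.2 residual_thinMaps), ?_⟩
  · exact (countable_bInter_mem hBc).2 fun V _ =>
      residual_union_interior_compl (isOpen_doubleTrap V)
  · exact (countable_bInter_mem hBc).2 fun V hV => residual_not_constant_on (hB.isOpen hV)
      (nonempty_iff_ne_empty.2 fun h => hB0 (h ▸ hV))
  rintro f ⟨⟨htrap, hnc⟩, hthin⟩
  have hconst : NowhereConstant f := by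
    rintro V hV ⟨x, hx⟩
    obtain ⟨W, hW, -, hWV⟩ := hB.exists_subset_of_mem_open hx hV
    obtain ⟨p, hp, q, hq, hpq⟩ := mem_iInter₂.1 hnc W hW
    exact ⟨p, hWV hp, q, hWV hq, hpq⟩
  have hdouble : ∀ y ∈ nonWandering f, ∀ V, IsOpen V → y ∈ V → ∃ W ⊆ V, f ∈ doubleTrap W := by
    intro y hy V hV hyV
    obtain ⟨W, hW, hyW, hWV⟩ := hB.exists_subset_of_mem_open hyV hV
    refine ⟨W, hWV, (mem_iInter₂.1 htrap W hW).resolve_right fun hint => ?_⟩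
    obtain ⟨δ, hδ, h⟩ := exists_pos_forall_comp_mem (isOpen_interior.mem_nhds hint)
    obtain ⟨ψ, hψ, hmem⟩ := exists_comp_mem_doubleTrap hconst (hB.isOpen hW) hyW hy hδ
    exact interior_subset (h ψ hψ) hmem
  have hdim := dimH_nonWandering_eq_zero (mem_iInter.1 hthin)
  have hphys : nonWandering f ⊆ physAttr (volume : Measure I01) f := by
    refine fun y hy => ⟨mem_univ y, ?_⟩
    rintro ⟨V, ⟨hV, hness⟩, hyV⟩
    obtain ⟨W, hWV, a, b, s, n, hs, hn, ha, -, -, hta, -⟩ := hdouble y hy V hV hyV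
    exact hness (essential_of_mapsTo _ hn (Metric.measure_ball_pos _ a hs).ne'
      (Metric.ball_subset_closedBall.trans (ha.trans hWV))
      (hta.mono_left Metric.ball_subset_closedBall))
  have h1 := physAttr_subset_statAttr (volume : Measure I01) f.continuous
  have h2 := statAttr_subset_milnorAttr (volume : Measure I01) f
  have h3 := milnorAttr_subset_nonWandering (volume : Measure I01) f
  have hclosed := isClosed_nonWandering f
  refine ⟨⟨?_, hclosed.isCompact, ⟨hclosed, fun y hy => ?_⟩,
    isTotallyDisconnected_of_dimH_lt_one (hdim ▸ zero_lt_one)⟩, hdim,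
    (h1.trans (h2.trans h3)).antisymm hphys, (h2.trans h3).antisymm (hphys.trans h1),
    h3.antisymm (hphys.trans (h1.trans h2))⟩
  · obtain ⟨z, -, hz⟩ := exists_mem_nonWandering_of_mapsTo (f := f) le_rfl isCompact_univ
      univ_nonempty (mapsTo_univ _ _)
    exact ⟨z, hz⟩
  · refine accPt_iff_nhds.2 fun V hV => ?_
    obtain ⟨W, hWV, a, b, s, n, hs, hn, ha, hb, hd, hta, htb⟩ := hdouble y hy _ isOpen_interior
      (mem_interior_iff_mem_nhds.2 hV)
    have hWV := hWV.trans interior_subset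
    obtain ⟨p, hpa, hp⟩ := exists_mem_nonWandering_of_mapsTo hn (isCompact_closedBall a s)
      (Metric.nonempty_closedBall.2 hs.le) (hta.mono_right Metric.ball_subset_closedBall)
    obtain ⟨q, hqb, hq⟩ := exists_mem_nonWandering_of_mapsTo hn (isCompact_closedBall b s)
      (Metric.nonempty_closedBall.2 hs.le) (htb.mono_right Metric.ball_subset_closedBall)
    by_cases hpy : p = y
    · exact ⟨q, ⟨hWV (hb hqb), hq⟩, fun hqy => disjoint_left.1 hd hpa (hpy ▸ hqy ▸ hqb)⟩
    · exact ⟨p, ⟨hWV (ha hpa), hp⟩, hpy⟩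
end
end

section
/- Let f : [0,1] → [0,1] be continuous and suppose there exist, for every i ≥ 1, an integer k_i ≥ 1 and nondegenerate closed intervals I_{i,1}, …, I_{i,k_i} ⊆ [0,1] such that f(I_{i,j}) ⊆ interior(I_{i,(j mod k_i)+1}) for all i, j, and max_{1≤j≤k_i} diam(I_{i,j}) → 0 as i → ∞; set S = ⋂_{i≥1} ⋃_{j=1}^{k_i} I_{i,j}. If (f_n)_{n∈ℕ} ⊆ C([0,1]) converges uniformly to f, then S ⊆ liminf_{n→∞} Λ(f_n); that is, for every z ∈ S and every ε > 0 there exists N ∈ ℕ such that for all n ≥ N, Λ(f_n) ∩ (z − ε, z + ε) ≠ ∅. -/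
open MeasureTheory Set Filter Topology

noncomputable section

theorem iterate_mem_of_mapsTo_cycle {X : Type*} {g : X → X} {k : ℕ} {J : ℕ → Set X}
    (hk : 0 < k) (hg : ∀ j < k, MapsTo g (J j) (J ((j + 1) % k))) {j : ℕ} {x : X}
    (hj : j < k) (hx : x ∈ J j) (m : ℕ) : g^[m] x ∈ J ((j + m) % k) := by
  induction m with
  | zero => simpa [Nat.mod_eq_of_lt hj] using hx
  | succ m ih =>
    rw [Function.iterate_succ_apply']
    have h := hg _ (Nat.mod_lt (j + m) hk) ih
    rwa [Nat.mod_add_mod, add_assoc] at h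

/-- An orbit returning infinitely often to a compact set has an ω-limit point there. -/
theorem omegaLim_inter_nonempty {X : Type*} [TopologicalSpace X] {g : X → X} {x : X}
    {K : Set X} (hK : IsCompact K) (hx : ∃ᶠ m in atTop, g^[m] x ∈ K) :
    (omegaLim g x ∩ K).Nonempty := by
  obtain ⟨y, hyK, hy⟩ := hK.exists_mapClusterPt_of_frequently hx
  refine ⟨y, mem_iInter.2 fun n => ?_, hyK⟩
  rw [mem_closure_iff_nhds]
  intro U hU
  obtain ⟨m, hnm, hm⟩ := (frequently_atTop.1 (mapClusterPt_iff_frequently.1 hy U hU)) n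
  exact ⟨_, hm, m, hnm, rfl⟩

/-- The Milnor attractor meets every compact set of positive measure all of whose points
have an ω-limit point in that set. -/
theorem milnorAttr_inter_nonempty {X : Type*} [TopologicalSpace X] [MeasurableSpace X]
    {lam : Measure X} {g : X → X} {K : Set X} (hK : IsCompact K) (hpos : lam K ≠ 0)
    (hω : ∀ x ∈ K, (omegaLim g x ∩ K).Nonempty) : (milnorAttr lam g ∩ K).Nonempty := by
  rw [inter_comm, milnorAttr, sInter_eq_iInter]
  refine hK.inter_iInter_nonempty _ (fun A => A.2.1) fun u => ?_
  have hae : ∀ᵐ x ∂lam, ∀ A ∈ u, omegaLim g x ⊆ A.1 :=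
    (Filter.eventually_all_finset u).2 fun A _ => A.2.2
  obtain ⟨x, hxK, hx⟩ := ((frequently_ae_mem_iff.2 hpos).and_eventually hae).exists
  obtain ⟨y, hy, hyK⟩ := hω x hxK
  exact ⟨y, hyK, mem_iInter₂.2 fun A hA => hx A hA hy⟩

/-- if `f` admits cycles of nondegenerate closed intervals, mapped into the
interiors of their cyclic successors, with diameters tending to zero, and `S` is their
nested intersection, then `S ⊆ liminf Λ(f_n)` for any sequence `f_n → f` uniformly. -/
theorem stmt8 (f : C(I01, I01)) (k : ℕ → ℕ) (J : ℕ → ℕ → Set I01)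
    (hk : ∀ i, 1 ≤ k i)
    (hJ : ∀ i j, j < k i → ∃ a b : I01, a < b ∧ J i j = Set.Icc a b)
    (hmap : ∀ i j, j < k i → ⇑f '' J i j ⊆ interior (J i ((j + 1) % k i)))
    (hdiam : ∀ ε > (0:ℝ), ∃ N, ∀ i ≥ N, ∀ j < k i, Metric.diam (J i j) < ε)
    (S : Set I01) (hS : S = ⋂ i, ⋃ j < k i, J i j)
    (F : ℕ → C(I01, I01)) (hF : Tendsto F atTop (nhds f)) :
    ∀ z ∈ S, ∀ ε > (0:ℝ), ∃ N : ℕ, ∀ n ≥ N,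
      (milnorAttr (volume : Measure I01) ⇑(F n) ∩ Metric.ball z ε).Nonempty := by
  intro z hz ε hε
  obtain ⟨i, hi⟩ := hdiam ε hε
  rw [hS] at hz
  obtain ⟨j, hj, hzj⟩ := mem_iUnion₂.1 (mem_iInter.1 hz i)
  have hcomp : ∀ l < k i, IsCompact (J i l) := fun l hl => by
    obtain ⟨a, b, -, h⟩ := hJ i l hl
    rw [h]
    exact isCompact_Icc
  have hev : ∀ᶠ n in atTop, ∀ l ∈ Finset.range (k i),
      MapsTo (F n) (J i l) (interior (J i ((l + 1) % k i))) := by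
    refine (Filter.eventually_all_finset _).2 fun l hl => ?_
    have hl' := Finset.mem_range.1 hl
    exact hF.eventually (ContinuousMap.eventually_mapsTo (hcomp l hl') isOpen_interior
      (mapsTo_iff_image_subset.2 (hmap i l hl')))
  obtain ⟨N, hN⟩ := eventually_atTop.1 hev
  refine ⟨N, fun n hn => ?_⟩
  have hcycle : ∀ l < k i, MapsTo (F n) (J i l) (J i ((l + 1) % k i)) := fun l hl =>
    (hN n hn l (Finset.mem_range.2 hl)).mono_right interior_subset
  have hpos : (volume : Measure I01) (J i j) ≠ 0 := by
    obtain ⟨a, b, hab, h⟩ := hJ i j hj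
    rw [h, unitInterval.volume_Icc]
    simpa using hab
  have hball : J i j ⊆ Metric.ball z ε := fun y hy =>
    (Metric.dist_le_diam_of_mem (hcomp j hj).isBounded hy hzj).trans_lt (hi i le_rfl j hj)
  refine (milnorAttr_inter_nonempty (hcomp j hj) hpos fun x hx =>
    omegaLim_inter_nonempty (hcomp j hj) ?_).mono (inter_subset_inter_right _ hball)
  refine frequently_atTop.2 fun m => ⟨k i * m, Nat.le_mul_of_pos_left m (hk i), ?_⟩
  have h := iterate_mem_of_mapsTo_cycle (hk i) hcycle hj hx (k i * m)
  rwa [Nat.add_mul_mod_self_left, Nat.mod_eq_of_lt hj] at h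
end
end

section
/- There exists a continuous map f : [0,1] → [0,1] such that A_phys(f) = {0}, A_stat(f) = {0,1}, and Λ(f) = [0,1]. In particular, the inclusions A_phys(f) ⊆ A_stat(f) ⊆ Λ(f) can both be strict. -/
open MeasureTheory Set Filter Topology

noncomputable section

/-- `θ ↦ x θ` parametrizes a family of dense `f`-orbits whose Birkhoff averages converge in
probability to the Dirac mass at `0`, while they almost surely accumulate at, and only at,
mixtures of the Dirac masses at `0` and at `1`. -/
structure AlternatingOrbits (f x : I01 → I01) : Prop where
  measurable : Measurable x
  tendsto_measure : ∀ U : Set I01, IsOpen U → 0 ∈ U → ∀ ε > (0:ℝ),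
    Tendsto (fun n => volume {θ | ε < birkhoffAvg f Uᶜ n (x θ)}) atTop (𝓝 0)
  tendsto_avg : ∀ U : Set I01, IsOpen U → 0 ∈ U → 1 ∈ U → ∀ θ,
    Tendsto (fun n => birkhoffAvg f Uᶜ n (x θ)) atTop (𝓝 0)
  frequently_zero : ∀ U : Set I01, IsOpen U → 0 ∈ U → ∀ θ,
    ∃ᶠ n in atTop, (1/2:ℝ) ≤ birkhoffAvg f U n (x θ)
  frequently_one : ∀ U : Set I01, IsOpen U → 1 ∈ U → ∀ θ,
    ∃ᶠ n in atTop, (1/2:ℝ) ≤ birkhoffAvg f U n (x θ)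
  frequently_mem : ∀ U : Set I01, IsOpen U → U.Nonempty → ∀ θ,
    ∃ᶠ n in atTop, f^[n] (x θ) ∈ U

theorem birkhoffAvg_mono {X : Type*} (f : X → X) {U V : Set X} (h : U ⊆ V) (n : ℕ) (x : X) :
    birkhoffAvg f U n x ≤ birkhoffAvg f V n x := by
  unfold birkhoffAvg
  gcongr

theorem birkhoffAvg_nonneg {X : Type*} (f : X → X) (U : Set X) (n : ℕ) (x : X) :
    0 ≤ birkhoffAvg f U n x :=
  div_nonneg (Finset.sum_nonneg fun _ _ => indicator_nonneg (fun _ _ => zero_le_one) _)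
    (Nat.cast_nonneg _)

theorem birkhoffAvg_add_compl {X : Type*} (f : X → X) (U : Set X) {n : ℕ} (hn : n ≠ 0) (x : X) :
    birkhoffAvg f U n x + birkhoffAvg f Uᶜ n x = 1 := by
  unfold birkhoffAvg
  rw [← add_div, ← Finset.sum_add_distrib]
  have : ∀ k, U.indicator (fun _ => (1:ℝ)) (f^[k] x) + Uᶜ.indicator (fun _ => (1:ℝ)) (f^[k] x)
      = 1 := fun k => by
    by_cases h : f^[k] x ∈ U <;> simp [h]
  simp [this, hn]

theorem Function.Semiconj.birkhoffAvg_eq {X Y : Type*} {f : X → X} {g : Y → Y} {h : X → Y}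
    (hfg : Function.Semiconj h f g) (U : Set Y) (n : ℕ) (x : X) :
    birkhoffAvg g U n (h x) = birkhoffAvg f (h ⁻¹' U) n x := by
  unfold birkhoffAvg
  congr 1
  refine Finset.sum_congr rfl fun k _ => ?_
  rw [← (hfg.iterate_right k) x]
  rfl

theorem measurable_birkhoffAvg {X : Type*} [MeasurableSpace X] {f : X → X} (hf : Measurable f)
    {U : Set X} (hU : MeasurableSet U) (n : ℕ) : Measurable (birkhoffAvg f U n) := by
  unfold birkhoffAvg
  refine Measurable.div_const (Finset.measurable_sum _ fun k _ => ?_) _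
  exact (measurable_const.indicator hU).comp (hf.iterate k)

theorem AlternatingOrbits.semiconj {f g x : I01 → I01} (hx : AlternatingOrbits f x)
    (h : I01 ≃ₜ I01) (hfg : Function.Semiconj h f g) (h0 : h 0 = 0) (h1 : h 1 = 1) :
    AlternatingOrbits g (h ∘ x) where
  measurable := h.continuous.measurable.comp hx.measurable
  tendsto_measure U hU hU0 ε hε := by
    simpa [hfg.birkhoffAvg_eq] using hx.tendsto_measure (h ⁻¹' U) (hU.preimage h.continuous)
      (by simpa [h0] using hU0) ε hε
  tendsto_avg U hU hU0 hU1 θ := by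
    simpa [hfg.birkhoffAvg_eq] using hx.tendsto_avg (h ⁻¹' U) (hU.preimage h.continuous)
      (by simpa [h0] using hU0) (by simpa [h1] using hU1) θ
  frequently_zero U hU hU0 θ := by
    simpa only [hfg.birkhoffAvg_eq, Function.comp_apply] using
      hx.frequently_zero (h ⁻¹' U) (hU.preimage h.continuous) (by simpa [h0] using hU0) θ
  frequently_one U hU hU1 θ := by
    simpa only [hfg.birkhoffAvg_eq, Function.comp_apply] using
      hx.frequently_one (h ⁻¹' U) (hU.preimage h.continuous) (by simpa [h1] using hU1) θ
  frequently_mem U hU hne θ := by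
    have := hx.frequently_mem (h ⁻¹' U) (hU.preimage h.continuous)
      (hne.preimage h.surjective) θ
    refine this.mono fun n hn => ?_
    rw [Function.comp_apply, ← (hfg.iterate_right n) (x θ)]
    exact hn

theorem AlternatingOrbits.measure_fiber {f x : I01 → I01} (hx : AlternatingOrbits f x) (p : I01) :
    volume (x ⁻¹' {p}) = 0 := by
  obtain ⟨V, U, hV, hU, hV0, hU1, hVU⟩ := t2_separation (zero_ne_one : (0 : I01) ≠ 1)
  rcases (x ⁻¹' {p}).eq_empty_or_nonempty with h | ⟨θ₀, hθ₀⟩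
  · simp [h]
  have hθ₀ : x θ₀ = p := hθ₀
  by_contra hne
  have h1 := (hx.tendsto_measure V hV hV0 (1/3) (by norm_num)).eventually_lt_const
    (pos_iff_ne_zero.mpr hne)
  obtain ⟨n, hn, hn'⟩ := ((hx.frequently_one U hU hU1 θ₀).and_eventually h1).exists
  refine hn'.not_ge (measure_mono fun θ hθ => ?_)
  have hθ : x θ = p := hθ
  have := birkhoffAvg_mono f (subset_compl_iff_disjoint_left.mpr hVU) n (x θ₀)
  simp only [mem_ofPred_eq, hθ]
  rw [hθ₀] at this hn
  linarith

theorem AlternatingOrbits.not_essential {f x : I01 → I01} (hx : AlternatingOrbits f x)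
    (hf : Continuous f) (hmp : MeasurePreserving x volume volume) {U V : Set I01} (hV : IsOpen V)
    (hV0 : 0 ∈ V) (hU : MeasurableSet U) (hUV : Disjoint U V) : ¬ Essential volume f U := by
  rintro ⟨ε, hε, δ, hδ, k, hk, h⟩
  have h1 := ((hx.tendsto_measure V hV hV0 ε hε).comp hk).eventually_lt_const
    (ENNReal.ofReal_pos.mpr hδ)
  obtain ⟨n, hn⟩ := h1.exists
  refine (h n).not_ge (le_trans ?_ hn.le)
  rw [← hmp.measure_preimage (measurableSet_lt measurable_const
    (measurable_birkhoffAvg hf.measurable hU _)).nullMeasurableSet]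
  refine measure_mono fun θ hθ => ?_
  exact lt_of_lt_of_le hθ (birkhoffAvg_mono f (subset_compl_iff_disjoint_right.mpr hUV) _ _)

theorem AlternatingOrbits.essential {f x : I01 → I01} (hx : AlternatingOrbits f x)
    (hf : Continuous f) (hmp : MeasurePreserving x volume volume) {U : Set I01} (hU : IsOpen U)
    (hU0 : 0 ∈ U) : Essential volume f U := by
  have h1 := (hx.tendsto_measure U hU hU0 (1/3) (by norm_num)).eventually_lt_const
    (show (0 : ENNReal) < ENNReal.ofReal (1/3) by simp)
  obtain ⟨N, hN⟩ := (h1.and (eventually_ne_atTop 0)).exists_forall_of_atTop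
  refine ⟨1/3, by norm_num, 1/3, by norm_num, fun n => n + N, tendsto_add_atTop_nat N, fun n => ?_⟩
  obtain ⟨h2, h3⟩ := hN (n + N) (by omega)
  rw [← hmp.measure_preimage (measurableSet_lt measurable_const
    (measurable_birkhoffAvg hf.measurable hU.measurableSet _)).nullMeasurableSet]
  by_contra! h4
  have h5 : (univ : Set I01) ⊆ {θ | 1/3 < birkhoffAvg f Uᶜ (n + N) (x θ)} ∪
      x ⁻¹' {y | 1/3 < birkhoffAvg f U (n + N) y} := by
    intro θ _
    have := birkhoffAvg_add_compl f U h3 (x θ)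
    simp only [mem_union, mem_ofPred_eq, mem_preimage]
    by_contra! h
    linarith
  have h6 := (measure_mono (μ := (volume : Measure I01)) h5).trans (measure_union_le _ _)
  have h7 := h6.trans (add_le_add h2.le h4)
  rw [← ENNReal.ofReal_add (by norm_num) (by norm_num), measure_univ,
    ENNReal.one_le_ofReal] at h7
  norm_num at h7

theorem AlternatingOrbits.physAttr_eq {f x : I01 → I01} (hx : AlternatingOrbits f x)
    (hf : Continuous f) (hmp : MeasurePreserving x volume volume) :
    physAttr (volume : Measure I01) f = {0} := by
  ext y
  simp only [physAttr, Set.mem_sdiff, mem_univ, true_and, mem_sUnion, mem_ofPred_eq, not_exists, not_and,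
    mem_singleton_iff]
  refine ⟨fun h => ?_, ?_⟩
  · by_contra hy
    obtain ⟨U, V, hU, hV, hUy, hV0, hUV⟩ := t2_separation hy
    exact h U ⟨hU, hx.not_essential hf hmp hV hV0 hU.measurableSet hUV⟩ hUy
  · rintro rfl U ⟨hU, h⟩ hU0
    exact h (hx.essential hf hmp hU hU0)

theorem AlternatingOrbits.statAttr_eq {f x : I01 → I01} (hx : AlternatingOrbits f x)
    (hf : Continuous f) (hmp : MeasurePreserving x volume volume) :
    statAttr (volume : Measure I01) f = {0, 1} := by
  have key : ∀ U : Set I01, (∀ θ, ∃ᶠ n in atTop, (1/2:ℝ) ≤ birkhoffAvg f U n (x θ)) →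
      ¬ ∀ᵐ y ∂(volume : Measure I01), Tendsto (fun n => birkhoffAvg f U n y) atTop (𝓝 0) := by
    intro U hU h
    obtain ⟨θ, hθ⟩ := (hmp.quasiMeasurePreserving.ae h).exists
    obtain ⟨n, hn, hn'⟩ := ((hU θ).and_eventually
      (hθ.eventually_lt_const (show (0:ℝ) < 1/2 by norm_num))).exists
    linarith
  ext y
  simp only [statAttr, Set.mem_sdiff, mem_univ, true_and, mem_sUnion, mem_ofPred_eq, not_exists, not_and,
    mem_singleton_iff, mem_insert_iff]
  refine ⟨fun h => ?_, ?_⟩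
  · by_contra! hy
    obtain ⟨U, V, hU, hV, hUy, hV0, hUV⟩ := t2_separation hy.1
    obtain ⟨U', V', hU', hV', hUy', hV1, hUV'⟩ := t2_separation hy.2
    refine h (U ∩ U') ⟨hU.inter hU', ?_⟩ ⟨hUy, hUy'⟩
    rw [← hmp.map_eq, ae_map_iff hmp.measurable.aemeasurable]
    · refine ae_of_all _ fun θ => ?_
      refine squeeze_zero (fun n => birkhoffAvg_nonneg _ _ _ _) (fun n => ?_)
        (hx.tendsto_avg (V ∪ V') (hV.union hV') (Or.inl hV0) (Or.inr hV1) θ)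
      refine birkhoffAvg_mono f ?_ _ _
      rw [subset_compl_iff_disjoint_right, disjoint_union_right]
      exact ⟨hUV.mono_left inter_subset_left, hUV'.mono_left inter_subset_right⟩
    · exact measurableSet_tendsto _ fun n =>
        measurable_birkhoffAvg hf.measurable (hU.inter hU').measurableSet n
  · rintro (rfl | rfl) U ⟨hU, h⟩ hUy
    · exact key U (hx.frequently_zero U hU hUy) h
    · exact key U (hx.frequently_one U hU hUy) h

theorem AlternatingOrbits.milnorAttr_eq {f x : I01 → I01} (hx : AlternatingOrbits f x)
    (hmp : MeasurePreserving x volume volume) :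
    milnorAttr (volume : Measure I01) f = univ := by
  refine eq_univ_of_forall fun y => ?_
  rintro A ⟨-, hA⟩
  obtain ⟨θ, hθ⟩ := (hmp.quasiMeasurePreserving.ae hA).exists
  refine hθ (mem_iInter.mpr fun n => mem_closure_iff.mpr fun U hU hUy => ?_)
  obtain ⟨m, hm, hm'⟩ := ((hx.frequently_mem U hU ⟨y, hUy⟩ θ).and_eventually
    (eventually_ge_atTop n)).exists
  exact ⟨_, hm, m, hm', rfl⟩

/-- A fully supported atomless probability measure on `[0,1]` is carried to Lebesgue measure by
an increasing homeomorphism. -/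
theorem exists_homeomorph_map_eq_volume (μ : Measure I01) [IsProbabilityMeasure μ]
    [μ.IsOpenPosMeasure] [NullSingletonClass μ] :
    ∃ h : I01 ≃ₜ I01, h 0 = 0 ∧ h 1 = 1 ∧ μ.map h = volume := by
  let F : I01 → I01 := fun x => ⟨μ.real (Iic x), measureReal_nonneg, measureReal_le_one⟩
  have h0 : F 0 = 0 := by
    have : Iic (0 : I01) = {0} := Iic_bot
    ext
    simp [F, this, measureReal_def]
  have h1 : F 1 = 1 := by
    have : Iic (1 : I01) = univ := Iic_top
    ext
    simp [F, this, measureReal_def]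
  have hmono : StrictMono F := by
    intro a b hab
    have hab' : (Ioo a b).Nonempty := nonempty_Ioo.mpr hab
    have h2 : Iic b = Iic a ∪ Ioc a b := (Iic_union_Ioc_eq_Iic hab.le).symm
    have h3 : 0 < μ.real (Ioc a b) := by
      rw [measureReal_def, ENNReal.toReal_pos_iff]
      exact ⟨(isOpen_Ioo.measure_pos μ hab').trans_le (measure_mono Ioo_subset_Ioc_self),
        measure_lt_top _ _⟩
    change μ.real (Iic a) < μ.real (Iic b)
    rw [h2, measureReal_union (Iic_disjoint_Ioc le_rfl) measurableSet_Ioc]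
    linarith
  have hcont : Continuous F := by
    let ν : Measure ℝ := μ.map Subtype.val
    have : IsProbabilityMeasure ν := Measure.isProbabilityMeasure_map (by fun_prop)
    have hF : ∀ x : I01, (F x : ℝ) = ProbabilityTheory.cdf ν x := fun x => by
      rw [ProbabilityTheory.cdf_eq_real, map_measureReal_apply (by fun_prop) measurableSet_Iic]
      rfl
    have hν : Continuous (ProbabilityTheory.cdf ν) := by
      refine continuous_iff_continuousAt.mpr fun y => ?_
      have hm := ProbabilityTheory.monotone_cdf ν
      rw [hm.continuousAt_iff_leftLim_eq_rightLim, StieltjesFunction.rightLim_eq]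
      refine le_antisymm (hm.leftLim_le le_rfl) ?_
      have h2 : ν {y} = 0 := by
        rw [Measure.map_apply (by fun_prop) (measurableSet_singleton _)]
        refine Set.Subsingleton.measure_zero (fun a ha b hb => ?_) _
        exact Subtype.ext (Eq.trans ha (Eq.symm hb))
      rw [← ProbabilityTheory.measure_cdf ν, StieltjesFunction.measure_singleton,
        ENNReal.ofReal_eq_zero] at h2
      linarith
    refine continuous_induced_rng.mpr ?_
    exact (hν.comp continuous_subtype_val).congr fun x => (hF x).symm
  have hsurj : Function.Surjective F := by
    intro y
    have := intermediate_value_univ (0 : I01) 1 hcont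
    rw [h0, h1] at this
    exact this ⟨y.2.1, y.2.2⟩
  let e : I01 ≃o I01 := hmono.orderIsoOfSurjective F hsurj
  refine ⟨e.toHomeomorph, h0, h1, ?_⟩
  have : IsProbabilityMeasure (μ.map e.toHomeomorph) :=
    Measure.isProbabilityMeasure_map e.toHomeomorph.continuous.aemeasurable
  refine Measure.ext_of_Iic _ _ fun a => ?_
  rw [Measure.map_apply e.toHomeomorph.continuous.measurable measurableSet_Iic]
  have h2 : e.toHomeomorph ⁻¹' Iic a = Iic (e.symm a) := by
    ext z
    exact (e.le_symm_apply).symm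
  have h3 : (F (e.symm a) : ℝ) = a := congrArg Subtype.val (e.apply_symm_apply a)
  rw [h2, ← ENNReal.ofReal_toReal (measure_ne_top μ _)]
  exact (congrArg ENNReal.ofReal h3).trans (unitInterval.volume_Iic a).symm

/-- The cubic map `s ↦ s (3 - 4 s)²`, which satisfies `sin² φ ↦ sin² (3 φ)`. -/
def sinTripling : C(I01, I01) where
  toFun s := ⟨s * (3 - 4 * s) ^ 2, mul_nonneg s.2.1 (sq_nonneg _), by
    have h := mul_nonneg (sub_nonneg.mpr s.2.2) (sq_nonneg (1 - 4 * (s : ℝ)))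
    nlinarith⟩
  continuous_toFun := by fun_prop

/-- The map `t ↦ sin² (π t)` from `ℝ` to `[0,1]`. -/
def sinSq (t : ℝ) : I01 := ⟨Real.sin (t * Real.pi) ^ 2, sq_nonneg _, Real.sin_sq_le_one _⟩

theorem continuous_sinSq : Continuous sinSq := by
  unfold sinSq
  fun_prop

theorem sinTripling_sinSq (t : ℝ) : sinTripling (sinSq t) = sinSq (3 * t) := by
  ext
  change Real.sin (t * Real.pi) ^ 2 * (3 - 4 * Real.sin (t * Real.pi) ^ 2) ^ 2 =
    Real.sin (3 * t * Real.pi) ^ 2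
  rw [mul_assoc 3, Real.sin_three_mul]
  ring

theorem iterate_sinTripling_sinSq (n : ℕ) (t : ℝ) :
    sinTripling^[n] (sinSq t) = sinSq (3 ^ n * t) := by
  induction n generalizing t with
  | zero => simp
  | succ n ih => rw [Function.iterate_succ_apply, sinTripling_sinSq, ih, pow_succ, mul_assoc]

theorem sinSq_natCast_add (k : ℕ) (t : ℝ) : sinSq (k + t) = sinSq t := by
  ext
  change Real.sin ((k + t) * Real.pi) ^ 2 = Real.sin (t * Real.pi) ^ 2
  rw [add_mul, add_comm, Real.sin_add_nat_mul_pi, mul_pow, ← pow_mul, mul_comm k 2, pow_mul]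
  simp

/-- The point of `[0,1]` coded by a sequence of ternary digits. -/
def sinCode (d : ℕ → Fin 3) : I01 := sinSq (Real.ofDigits d)

theorem continuous_sinCode : Continuous sinCode :=
  continuous_sinSq.comp Real.continuous_ofDigits

theorem three_mul_ofDigits (d : ℕ → Fin 3) :
    3 * Real.ofDigits d = (d 0 : ℕ) + Real.ofDigits fun i => d (i + 1) := by
  rw [Real.ofDigits_eq_sum_add_ofDigits d 1]
  simp [Real.ofDigitsTerm]
  ring

theorem sinTripling_sinCode (d : ℕ → Fin 3) :
    sinTripling (sinCode d) = sinCode fun i => d (i + 1) := by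
  unfold sinCode
  rw [sinTripling_sinSq, three_mul_ofDigits, sinSq_natCast_add]

theorem iterate_sinTripling_sinCode (n : ℕ) (d : ℕ → Fin 3) :
    sinTripling^[n] (sinCode d) = sinCode fun i => d (n + i) := by
  induction n generalizing d with
  | zero => simp
  | succ n ih =>
    rw [Function.iterate_succ_apply, sinTripling_sinCode, ih]
    simp only [add_right_comm]

theorem sinCode_zero : sinCode (fun _ => 0) = 0 := by
  ext
  simp [sinCode, sinSq, Real.ofDigits, Real.ofDigitsTerm]

theorem sinCode_one : sinCode (fun _ => 1) = 1 := by
  have h := three_mul_ofDigits fun _ => 1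
  have h2 : Real.ofDigits (fun _ => (1 : Fin 3)) = 1 / 2 := by
    simp at h
    linarith
  ext
  simp only [sinCode, sinSq, h2]
  rw [one_div_mul_eq_div, Real.sin_pi_div_two]
  simp

theorem exists_sinSq_eq (y : I01) : ∃ t ∈ Icc (0:ℝ) 1, sinSq t = y := by
  have h : (y : ℝ) ∈ (fun t => Real.sin (t * Real.pi) ^ 2) '' Icc 0 (1 / 2) :=
    intermediate_value_Icc (by norm_num) (by fun_prop)
      (by rw [one_div_mul_eq_div, Real.sin_pi_div_two]; simp)
  obtain ⟨t, ht, hty⟩ := h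
  exact ⟨t, ⟨ht.1, ht.2.trans (by norm_num)⟩, Subtype.ext hty⟩

theorem sinCode_surjective : Function.Surjective sinCode := by
  intro y
  obtain ⟨t, ht, rfl⟩ := exists_sinSq_eq y
  obtain ⟨d, -, hd⟩ := Real.ofDigits_SurjOn (b := 3) (by norm_num) ht
  exact ⟨d, by rw [sinCode, hd]⟩

theorem exists_forall_agree_mem {V : Set (ℕ → Fin 3)} (hV : IsOpen V) {s : ℕ → Fin 3}
    (hs : s ∈ V) : ∃ m : ℕ, ∀ d : ℕ → Fin 3, (∀ i < m, d i = s i) → d ∈ V := by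
  obtain ⟨_, ⟨x, n, rfl⟩, hsx, hxV⟩ :=
    (PiNat.isTopologicalBasis_cylinders fun _ : ℕ => Fin 3).exists_subset_of_mem_open hs hV
  refine ⟨n, fun d hd => hxV ?_⟩
  rw [← PiNat.mem_cylinder_iff_eq.mp hsx]
  exact hd

/-- The index `j` of the block `[2 ^ (j ^ 2), 2 ^ ((j + 1) ^ 2))` containing `n`. -/
def blockIndex (n : ℕ) : ℕ := Nat.sqrt (Nat.log 2 n)

theorem le_blockIndex_iff {n : ℕ} (hn : n ≠ 0) (j : ℕ) : j ≤ blockIndex n ↔ 2 ^ (j ^ 2) ≤ n := by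
  rw [blockIndex, Nat.le_sqrt', Nat.le_log_iff_pow_le (by norm_num) hn]

theorem blockIndex_eq {n j : ℕ} (h1 : 2 ^ (j ^ 2) ≤ n) (h2 : n < 2 ^ ((j + 1) ^ 2)) :
    blockIndex n = j := by
  have hn : n ≠ 0 := (lt_of_lt_of_le (by positivity) h1).ne'
  have h3 := (le_blockIndex_iff hn j).mpr h1
  have h4 := mt (le_blockIndex_iff hn (j + 1)).mp h2.not_ge
  omega

theorem tendsto_blockIndex : Tendsto blockIndex atTop atTop := by
  refine tendsto_atTop.mpr fun j => ?_
  filter_upwards [eventually_ge_atTop (2 ^ (j ^ 2))] with n hn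
  exact (le_blockIndex_iff (lt_of_lt_of_le (by positivity) hn).ne' j).mpr hn

theorem two_pow_sq_add_le (j : ℕ) : 2 ^ (j ^ 2) + j ≤ 2 ^ ((j + 1) ^ 2) := by
  have h1 : j < 2 ^ (j ^ 2) := (Nat.lt_two_pow_self).trans_le
    (Nat.pow_le_pow_right (by norm_num) (Nat.le_self_pow (by norm_num) j))
  have h2 : 2 * 2 ^ (j ^ 2) ≤ 2 ^ ((j + 1) ^ 2) := by
    rw [← pow_succ']
    exact Nat.pow_le_pow_right (by norm_num) (by nlinarith)
  omega

theorem tendsto_blockRatio (C : ℝ) :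
    Tendsto (fun j : ℕ => (C + 2 ^ (j ^ 2) + 3 * j) / (2:ℝ) ^ ((j + 1) ^ 2)) atTop (𝓝 0) := by
  have h1 : ∀ j : ℕ, (j : ℝ) ≤ 2 ^ (j ^ 2) := fun j => by
    have : j ≤ 2 ^ (j ^ 2) := (Nat.lt_two_pow_self).le.trans
      (Nat.pow_le_pow_right (by norm_num) (Nat.le_self_pow (by norm_num) j))
    exact_mod_cast this
  have hone : ∀ j : ℕ, (1 : ℝ) ≤ 2 ^ (j ^ 2) := fun j => one_le_pow₀ (by norm_num)
  have h2 : Tendsto (fun j : ℕ => (|C| + 4) * (1/2 : ℝ) ^ j) atTop (𝓝 0) := by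
    simpa using (tendsto_pow_atTop_nhds_zero_of_lt_one (r := (1/2:ℝ)) (by norm_num)
      (by norm_num)).const_mul (|C| + 4)
  refine squeeze_zero_norm (fun j => ?_) h2
  rw [Real.norm_eq_abs, abs_div, abs_of_pos (a := (2:ℝ) ^ ((j + 1) ^ 2)) (by positivity),
    div_le_iff₀ (by positivity)]
  have h3 : |C + 2 ^ (j ^ 2) + 3 * j| ≤ (|C| + 4) * 2 ^ (j ^ 2) := by
    have := abs_nonneg C
    rw [abs_le]
    constructor <;> nlinarith [h1 j, hone j, neg_abs_le C, le_abs_self C,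
      mul_le_mul_of_nonneg_left (hone j) this, (Nat.cast_nonneg j : (0:ℝ) ≤ j)]
  refine h3.trans ?_
  rw [mul_assoc]
  gcongr
  rw [show (j + 1) ^ 2 = j + (j ^ 2 + (j + 1)) by ring, pow_add, ← mul_assoc, ← mul_pow]
  norm_num
  exact pow_le_pow_right₀ (by norm_num) (by omega)

/-- The digit sequence whose `j`-th block starts with `j` digits of the sequence number
`(Nat.unpair j).1` of a fixed dense family and continues with copies of the digit `c j`. -/
def blockSeq (c : ℕ → Fin 3) (n : ℕ) : Fin 3 :=
  if n < 2 ^ (blockIndex n ^ 2) + blockIndex n then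
    TopologicalSpace.denseSeq (ℕ → Fin 3) (Nat.unpair (blockIndex n)).1
      (n - 2 ^ (blockIndex n ^ 2))
  else c (blockIndex n)

theorem blockSeq_start (c : ℕ → Fin 3) {i j : ℕ} (hi : i < j) :
    blockSeq c (2 ^ (j ^ 2) + i) =
      TopologicalSpace.denseSeq (ℕ → Fin 3) (Nat.unpair j).1 i := by
  have h := two_pow_sq_add_le j
  have h2 : blockIndex (2 ^ (j ^ 2) + i) = j := blockIndex_eq (by omega) (by omega)
  simp [blockSeq, h2, hi]

theorem blockSeq_tail (c : ℕ → Fin 3) {n j : ℕ} (h1 : 2 ^ (j ^ 2) + j ≤ n)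
    (h2 : n < 2 ^ ((j + 1) ^ 2)) : blockSeq c n = c j := by
  have h3 : blockIndex n = j := blockIndex_eq (by omega) h2
  simp [blockSeq, h3, h1]

theorem iterate_blockSeq_mem {c : ℕ → Fin 3} {U : Set I01} {j m k : ℕ}
    (hU : ∀ d : ℕ → Fin 3, (∀ i < m, d i = c j) → sinCode d ∈ U)
    (h1 : 2 ^ (j ^ 2) + j ≤ k) (h2 : k < 2 ^ ((j + 1) ^ 2) - m) :
    sinTripling^[k] (sinCode (blockSeq c)) ∈ U := by
  rw [iterate_sinTripling_sinCode]
  exact hU _ fun i hi => blockSeq_tail c (by omega) (by omega)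

theorem birkhoffAvg_compl_le {X : Type*} {f : X → X} {U : Set X} {x y : X} {q n : ℕ}
    (hxy : f^[q] x = y) (B : Finset ℕ) (hB : ∀ k < n, k ∉ B → f^[k] y ∈ U) :
    birkhoffAvg f Uᶜ n x ≤ (q + B.card : ℕ) / n := by
  classical
  unfold birkhoffAvg
  gcongr
  let T := Finset.range q ∪ B.image (· + q)
  calc ∑ k ∈ Finset.range n, Uᶜ.indicator (fun _ => (1:ℝ)) (f^[k] x)
      ≤ ∑ k ∈ Finset.range n, if k ∈ T then (1:ℝ) else 0 := by
        refine Finset.sum_le_sum fun k hk => ?_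
        by_cases hT : k ∈ T
        · simp only [hT, if_true]
          exact indicator_le_self' (fun _ _ => zero_le_one) _
        · simp only [T, Finset.mem_union, Finset.mem_range, Finset.mem_image, not_or,
            not_exists, not_and, not_lt] at hT
          have h1 := hB (k - q) (by have := Finset.mem_range.mp hk; omega)
            fun h => hT.2 _ h (Nat.sub_add_cancel hT.1)
          rw [← hxy, ← Function.iterate_add_apply, Nat.sub_add_cancel hT.1] at h1
          rw [indicator_of_notMem (by simpa using h1)]
          split_ifs <;> norm_num
    _ = ((Finset.range n).filter (· ∈ T)).card := by
        rw [← Finset.sum_filter, Finset.sum_const, nsmul_one]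
    _ ≤ (q + B.card : ℕ) := by
        norm_cast
        refine (Finset.card_le_card fun k hk => (Finset.mem_filter.mp hk).2).trans ?_
        refine (Finset.card_union_le _ _).trans ?_
        rw [Finset.card_range]
        exact Nat.add_le_add_left Finset.card_image_le q

theorem birkhoffAvg_blockSeq_le {c : ℕ → Fin 3} {U : Set I01} {x : I01} {j m n q : ℕ}
    (hx : sinTripling^[q] x = sinCode (blockSeq c))
    (hU : ∀ d : ℕ → Fin 3, (∀ i < m, d i = c j) → sinCode d ∈ U)
    (hU' : ∀ d : ℕ → Fin 3, (∀ i < m, d i = c (j + 1)) → sinCode d ∈ U)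
    (h1 : 2 ^ ((j + 1) ^ 2) ≤ n) (h2 : n ≤ 2 ^ ((j + 2) ^ 2)) :
    birkhoffAvg sinTripling Uᶜ n x ≤
      (q + 2 * m + 1 + 2 ^ (j ^ 2) + 2 * j) / (2:ℝ) ^ ((j + 1) ^ 2) := by
  let B := Finset.range (2 ^ (j ^ 2) + j) ∪
    (Finset.Ico (2 ^ ((j + 1) ^ 2) - m) (2 ^ ((j + 1) ^ 2) + (j + 1)) ∪
      Finset.Ico (2 ^ ((j + 2) ^ 2) - m) (2 ^ ((j + 2) ^ 2)))
  have hB : B.card ≤ 2 ^ (j ^ 2) + j + ((m + (j + 1)) + m) := by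
    refine (Finset.card_union_le _ _).trans (Nat.add_le_add (by simp) ?_)
    refine (Finset.card_union_le _ _).trans (Nat.add_le_add ?_ ?_) <;>
    · rw [Nat.card_Ico]
      omega
  have h3 := birkhoffAvg_compl_le (U := U) (n := n) hx B fun k hk hkB => by
    simp only [B, Finset.mem_union, Finset.mem_range, Finset.mem_Ico, not_or, not_and,
      not_lt] at hkB
    obtain ⟨h4, h5, h6⟩ := hkB
    by_cases h7 : 2 ^ ((j + 1) ^ 2) - m ≤ k
    · exact iterate_blockSeq_mem hU' (h5 h7) (by
        by_contra! h8
        have := h6 h8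
        omega)
    · exact iterate_blockSeq_mem hU h4 (not_le.mp h7)
  refine h3.trans ?_
  gcongr
  · have : q + B.card ≤ q + 2 * m + 1 + 2 ^ (j ^ 2) + 2 * j := by omega
    exact_mod_cast this
  · exact_mod_cast h1

theorem frequently_birkhoffAvg_blockSeq {c : ℕ → Fin 3} {U : Set I01} {x : I01} {q : ℕ}
    (hx : sinTripling^[q] x = sinCode (blockSeq c)) (hU : IsOpen U) {a : Fin 3}
    (ha : sinCode (fun _ => a) ∈ U) (hc : ∃ᶠ j in atTop, c j = a) :
    ∃ᶠ n in atTop, (1/2:ℝ) ≤ birkhoffAvg sinTripling U n x := by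
  obtain ⟨m, hm⟩ := exists_forall_agree_mem (hU.preimage continuous_sinCode) ha
  have hlim := (tendsto_blockRatio (q + m)).eventually_le_const (show (0:ℝ) < 1/2 by norm_num)
  have htend : Tendsto (fun j : ℕ => 2 ^ ((j + 1) ^ 2)) atTop atTop :=
    tendsto_atTop_mono
      (fun j => (Nat.le_add_left _ _).trans (two_pow_sq_add_le j)) tendsto_id
  refine htend.frequently ((hc.and_eventually hlim).mono fun j hj => ?_)
  obtain ⟨hcj, hj⟩ := hj
  let B := Finset.range (2 ^ (j ^ 2) + j) ∪
    Finset.Ico (2 ^ ((j + 1) ^ 2) - m) (2 ^ ((j + 1) ^ 2))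
  have hB : B.card ≤ 2 ^ (j ^ 2) + j + m := by
    refine (Finset.card_union_le _ _).trans (Nat.add_le_add (by simp) ?_)
    rw [Nat.card_Ico]
    omega
  have h3 := birkhoffAvg_compl_le (U := U) (n := 2 ^ ((j + 1) ^ 2)) hx B fun k hk hkB => by
    simp only [B, Finset.mem_union, Finset.mem_range, Finset.mem_Ico, not_or, not_and,
      not_lt] at hkB
    exact iterate_blockSeq_mem (m := m) (fun d hd => hm d (by simpa [hcj] using hd)) hkB.1 (by
      by_contra! h8
      have := hkB.2 h8
      omega)
  have h4 := birkhoffAvg_add_compl sinTripling U (n := 2 ^ ((j + 1) ^ 2)) (by positivity) x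
  have h5 : ((q + B.card : ℕ) : ℝ) / (2 ^ ((j + 1) ^ 2) : ℕ) ≤ 1/2 := by
    refine le_trans ?_ hj
    rw [Nat.cast_pow, Nat.cast_ofNat]
    refine div_le_div_of_nonneg_right ?_ (by positivity)
    have : q + B.card ≤ q + m + 2 ^ (j ^ 2) + 3 * j := by omega
    exact_mod_cast this
  linarith

theorem frequently_iterate_blockSeq_mem {c : ℕ → Fin 3} {U : Set I01} {x : I01} {q : ℕ}
    (hx : sinTripling^[q] x = sinCode (blockSeq c)) (hU : IsOpen U) (hne : U.Nonempty) :
    ∃ᶠ n in atTop, sinTripling^[n] x ∈ U := by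
  have hV := hU.preimage continuous_sinCode
  obtain ⟨a, ha⟩ := (TopologicalSpace.denseRange_denseSeq (ℕ → Fin 3)).exists_mem_open hV
    (hne.preimage sinCode_surjective)
  obtain ⟨m, hm⟩ := exists_forall_agree_mem hV ha
  refine frequently_atTop.mpr fun n => ?_
  let j := Nat.pair a (n + m)
  have hj : n + m ≤ j := Nat.right_le_pair _ _
  have h1 : j < 2 ^ (j ^ 2) := (Nat.lt_two_pow_self).trans_le
    (Nat.pow_le_pow_right (by norm_num) (Nat.le_self_pow (by norm_num) j))
  refine ⟨2 ^ (j ^ 2) + q, by omega, ?_⟩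
  rw [Function.iterate_add_apply, hx, iterate_sinTripling_sinCode]
  refine hm _ fun i hi => ?_
  rw [blockSeq_start c (by omega), Nat.unpair_pair]

/-- A sequence of windows in `[0,1]` whose lengths tend to zero and which sweep the interval
again and again. -/
def sweepingWindow (j : ℕ) : Set I01 :=
  (fun θ => 2 ^ Nat.log 2 j * (1 + (θ : ℝ))) ⁻¹' Icc (j : ℝ) (j + 1)

theorem measurableSet_sweepingWindow (j : ℕ) : MeasurableSet (sweepingWindow j) :=
  (show Measurable fun θ : I01 => 2 ^ Nat.log 2 j * (1 + (θ : ℝ)) by fun_prop) measurableSet_Icc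

theorem tendsto_volume_sweepingWindow :
    Tendsto (fun j => volume (sweepingWindow j)) atTop (𝓝 0) := by
  have h1 : ∀ j, volume (sweepingWindow j) ≤ ENNReal.ofReal ((1/2) ^ Nat.log 2 j) := fun j => by
    have hpos : (0:ℝ) < 2 ^ Nat.log 2 j := by positivity
    have h2 : sweepingWindow j = Subtype.val ⁻¹'
        Icc ((j:ℝ) / 2 ^ Nat.log 2 j - 1) ((j + 1:ℝ) / 2 ^ Nat.log 2 j - 1) := by
      ext θ
      simp only [sweepingWindow, mem_preimage, mem_Icc, sub_le_iff_le_add,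
        le_sub_iff_add_le, div_le_iff₀ hpos, le_div_iff₀ hpos]
      constructor <;> rintro ⟨h, h'⟩ <;> constructor <;> linarith
    rw [h2]
    refine (unitInterval.measurePreserving_coe.measure_preimage
      measurableSet_Icc.nullMeasurableSet).trans_le ?_
    refine (Measure.restrict_apply_le _ _).trans ?_
    rw [Real.volume_Icc]
    refine ENNReal.ofReal_le_ofReal (le_of_eq ?_)
    rw [div_pow, one_pow]
    ring
  have h2 : Tendsto (Nat.log 2) atTop atTop := by
    refine tendsto_atTop.mpr fun k => ?_
    filter_upwards [eventually_ge_atTop (2 ^ k)] with n hn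
    exact (Nat.le_log_iff_pow_le (by norm_num) (lt_of_lt_of_le (by positivity) hn).ne').mpr hn
  have h3 := ENNReal.tendsto_ofReal ((tendsto_pow_atTop_nhds_zero_of_lt_one (r := (1/2:ℝ))
    (by norm_num) (by norm_num)).comp h2)
  rw [ENNReal.ofReal_zero] at h3
  exact tendsto_of_tendsto_of_tendsto_of_le_of_le tendsto_const_nhds h3 (fun _ => zero_le) h1

theorem frequently_mem_sweepingWindow (θ : I01) : ∃ᶠ j in atTop, θ ∈ sweepingWindow j := by
  refine frequently_atTop.mpr fun k => ?_
  have hk : k < 2 ^ k := Nat.lt_two_pow_self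
  have h0 := θ.2.1
  have h1 := θ.2.2
  have h2k : (0:ℝ) < 2 ^ k := by positivity
  suffices ∃ j : ℕ, 2 ^ k ≤ j ∧ j < 2 ^ (k + 1) ∧ (j : ℝ) ≤ 2 ^ k * (1 + θ) ∧
      2 ^ k * (1 + (θ : ℝ)) ≤ j + 1 by
    obtain ⟨j, hj, hj', h⟩ := this
    have hlog : Nat.log 2 j = k := Nat.log_eq_of_pow_le_of_lt_pow hj hj'
    exact ⟨j, by omega, by simpa [sweepingWindow, hlog] using h⟩
  rcases h1.lt_or_eq with h | h
  · refine ⟨⌊2 ^ k * (1 + (θ : ℝ))⌋₊, Nat.le_floor ?_, ?_, Nat.floor_le (by positivity),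
      (Nat.lt_floor_add_one _).le⟩
    · push_cast
      nlinarith
    · rw [Nat.floor_lt (by positivity)]
      push_cast
      rw [pow_succ]
      nlinarith
  · refine ⟨2 ^ (k + 1) - 1, ?_, ?_, ?_⟩
    · rw [pow_succ]
      omega
    · have : 0 < 2 ^ (k + 1) := by positivity
      omega
    · rw [Nat.cast_sub Nat.one_le_two_pow, h]
      push_cast
      rw [pow_succ]
      constructor <;> linarith

theorem frequently_notMem_sweepingWindow (θ : I01) : ∃ᶠ j in atTop, θ ∉ sweepingWindow j := by
  refine frequently_atTop.mpr fun n => ?_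
  by_contra! h
  let k := n + 2
  have hk : k < 2 ^ k := Nat.lt_two_pow_self
  have hk' : 4 ≤ 2 ^ k := by
    calc 4 = 2 ^ 2 := rfl
      _ ≤ 2 ^ k := Nat.pow_le_pow_right (by norm_num) (by omega)
  have h1 := (h (2 ^ k) (by omega)).2
  have h2 := (h (2 ^ k + 2) (by omega)).1
  have hlog : Nat.log 2 (2 ^ k) = k := Nat.log_pow (by norm_num) k
  have hlog' : Nat.log 2 (2 ^ k + 2) = k :=
    Nat.log_eq_of_pow_le_of_lt_pow (by omega) (by rw [pow_succ _ k]; omega)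
  rw [hlog] at h1
  rw [hlog'] at h2
  push_cast at h1 h2
  linarith

/-- A measurable function on `[0,1]` that takes every natural number as a value with positive
probability. -/
def randomIndex (θ : I01) : ℕ := ⌊(θ : ℝ)⁻¹⌋₊ - 1

theorem measurable_randomIndex : Measurable randomIndex :=
  (measurable_from_nat (f := fun n => n - 1)).comp
    (Nat.measurable_floor.comp (by fun_prop))

theorem volume_randomIndex_pos (N : ℕ) : 0 < volume {θ | randomIndex θ = N} := by
  have hN : (0:ℝ) ≤ N := Nat.cast_nonneg N
  let a : I01 := ⟨1 / (N + 2), by positivity, by rw [div_le_one (by positivity)]; linarith⟩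
  let b : I01 := ⟨1 / (N + 1), by positivity, by rw [div_le_one (by positivity)]; linarith⟩
  have hlt : 1 / (N + 2 : ℝ) < 1 / (N + 1 : ℝ) := by
    gcongr
    norm_num
  have hpos : 0 < volume (Ioo a b) := by
    rw [unitInterval.volume_Ioo, ENNReal.ofReal_pos]
    exact sub_pos.mpr hlt
  refine hpos.trans_le (measure_mono fun θ hθ => ?_)
  have h1 : 1 / (N + 2 : ℝ) < θ := hθ.1
  have h2 : (θ : ℝ) < 1 / (N + 1) := hθ.2
  have h0 : (0:ℝ) < θ := lt_trans (by positivity) h1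
  rw [div_lt_comm₀ (by positivity) h0, one_div] at h1
  rw [lt_div_comm₀ h0 (by positivity), one_div] at h2
  have h3 : ⌊(θ : ℝ)⁻¹⌋₊ = N + 1 := by
    rw [Nat.floor_eq_iff (by positivity)]
    push_cast
    constructor <;> linarith
  simp [randomIndex, h3]

theorem tendsto_volume_randomIndex :
    Tendsto (fun j => volume {θ | j < randomIndex θ}) atTop (𝓝 0) := by
  have h := tendsto_measure_iInter_atTop (μ := (volume : Measure I01))
    (s := fun j : ℕ => {θ | j < randomIndex θ})
    (fun j => (measurable_randomIndex (measurableSet_Ioi (a := j))).nullMeasurableSet)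
    (fun i j hij θ hθ => lt_of_le_of_lt hij hθ) ⟨0, measure_ne_top _ _⟩
  have h2 : ⋂ j : ℕ, {θ | j < randomIndex θ} = ∅ := by
    refine eq_empty_of_forall_notMem fun θ hθ => ?_
    exact lt_irrefl (randomIndex θ) (mem_iInter.mp hθ (randomIndex θ))
  rwa [h2, measure_empty] at h

open Classical in
/-- The constant digits of the blocks at the parameter `θ`. -/
def windowDigit (θ : I01) (j : ℕ) : Fin 3 := if θ ∈ sweepingWindow j then 1 else 0

/-- A random point of `[0,1]` that, after a random number of iterations of `sinTripling`, is coded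
by `blockSeq (windowDigit θ)`. -/
def randomPoint (θ : I01) : I01 :=
  sinSq (((randomIndex θ).unpair.2 + Real.ofDigits (blockSeq (windowDigit θ))) /
    3 ^ (randomIndex θ).unpair.1)

theorem iterate_randomPoint (θ : I01) :
    sinTripling^[(randomIndex θ).unpair.1] (randomPoint θ) =
      sinCode (blockSeq (windowDigit θ)) := by
  rw [randomPoint, iterate_sinTripling_sinSq, mul_div_cancel₀ _ (by positivity),
    sinSq_natCast_add, sinCode]

theorem measurable_randomPoint : Measurable randomPoint := by
  have h1 : Measurable fun θ => blockSeq (windowDigit θ) := by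
    refine measurable_pi_iff.mpr fun n => ?_
    unfold blockSeq
    split_ifs
    · exact measurable_const
    · exact Measurable.ite (measurableSet_sweepingWindow _) measurable_const measurable_const
  have h2 : Measurable fun θ => Real.ofDigits (blockSeq (windowDigit θ)) :=
    Real.continuous_ofDigits.measurable.comp h1
  have h3 : Measurable fun θ => ((randomIndex θ).unpair.2 : ℝ) :=
    (measurable_from_nat (f := fun n => (n.unpair.2 : ℝ))).comp measurable_randomIndex
  have h4 : Measurable fun θ => (3:ℝ) ^ (randomIndex θ).unpair.1 :=
    (measurable_from_nat (f := fun n => (3:ℝ) ^ n.unpair.1)).comp measurable_randomIndex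
  exact continuous_sinSq.measurable.comp ((h3.add h2).div h4)

theorem exists_forall_randomPoint_mem {U : Set I01} (hU : IsOpen U) (hne : U.Nonempty) :
    ∃ N, ∀ θ, randomIndex θ = N → randomPoint θ ∈ U := by
  obtain ⟨y, hy⟩ := hne
  obtain ⟨t, ht, rfl⟩ := exists_sinSq_eq y
  obtain ⟨δ, hδ, hδU⟩ := Metric.isOpen_iff.mp (hU.preimage continuous_sinSq) t hy
  obtain ⟨m, hm⟩ := exists_pow_lt_of_lt_one hδ (show (1/3:ℝ) < 1 by norm_num)
  refine ⟨Nat.pair m ⌊t * 3 ^ m⌋₊, fun θ hθ => ?_⟩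
  rw [randomPoint, hθ, Nat.unpair_pair]
  refine hδU ?_
  rw [Metric.mem_ball, Real.dist_eq]
  refine lt_of_le_of_lt ?_ hm
  have h3 : (0:ℝ) < 3 ^ m := by positivity
  have h4 := Nat.floor_le (show 0 ≤ t * 3 ^ m from mul_nonneg ht.1 h3.le)
  have h5 := Nat.lt_floor_add_one (t * 3 ^ m)
  have h6 := Real.ofDigits_nonneg (blockSeq (windowDigit θ))
  have h7 := Real.ofDigits_le_one (blockSeq (windowDigit θ))
  rw [div_sub' h3.ne', abs_div, abs_of_pos h3, div_pow, one_pow]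
  gcongr
  rw [abs_le]
  constructor <;> linarith

theorem measure_preimage_randomPoint_pos {U : Set I01} (hU : IsOpen U) (hne : U.Nonempty) :
    0 < volume (randomPoint ⁻¹' U) := by
  obtain ⟨N, hN⟩ := exists_forall_randomPoint_mem hU hne
  exact (volume_randomIndex_pos N).trans_le (measure_mono hN)

/-- Every large time lies in a block of positive index for which the error term is small. -/
theorem eventually_exists_block {C ε : ℝ} (hε : 0 < ε) :
    ∀ᶠ n in atTop, ∃ j, blockIndex n = j + 1 ∧ 2 ^ ((j + 1) ^ 2) ≤ n ∧ n ≤ 2 ^ ((j + 2) ^ 2) ∧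
      (C + 2 ^ (j ^ 2) + 3 * j) / (2:ℝ) ^ ((j + 1) ^ 2) ≤ ε := by
  have h1 := ((tendsto_sub_atTop_nat 1).comp tendsto_blockIndex).eventually
    ((tendsto_blockRatio C).eventually_le_const hε)
  filter_upwards [h1, tendsto_blockIndex.eventually_ge_atTop 1, eventually_ne_atTop 0]
    with n hn h2 h3
  refine ⟨blockIndex n - 1, by omega, ?_, ?_, hn⟩
  · rw [← le_blockIndex_iff h3]
    omega
  · have h4 := mt (le_blockIndex_iff h3 (blockIndex n + 1)).mpr (by omega)
    rw [show blockIndex n - 1 + 2 = blockIndex n + 1 by omega]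
    omega

theorem alternatingOrbits_randomPoint : AlternatingOrbits sinTripling randomPoint where
  measurable := measurable_randomPoint
  tendsto_measure U hU hU0 ε hε := by
    obtain ⟨m, hm⟩ := exists_forall_agree_mem (hU.preimage continuous_sinCode)
      (s := fun _ => 0) (by simpa [sinCode_zero] using hU0)
    have hlim : Tendsto (fun j => volume {θ | j < randomIndex θ} + volume (sweepingWindow j) +
        volume (sweepingWindow (j + 1))) atTop (𝓝 0) := by
      simpa using (tendsto_volume_randomIndex.add tendsto_volume_sweepingWindow).add
        (tendsto_volume_sweepingWindow.comp (tendsto_add_atTop_nat 1))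
    have hlim' := hlim.comp ((tendsto_sub_atTop_nat 1).comp tendsto_blockIndex)
    refine tendsto_of_tendsto_of_tendsto_of_le_of_le' tendsto_const_nhds hlim'
      (Eventually.of_forall fun _ => zero_le) ?_
    filter_upwards [eventually_exists_block (C := 2 * m + 1) hε] with n hn
    obtain ⟨j, hj, h1, h2, h3⟩ := hn
    simp only [Function.comp_apply, hj, Nat.add_sub_cancel]
    refine (measure_mono fun θ hθ => ?_).trans ((measure_union_le _ _).trans
      (add_le_add_left (measure_union_le _ _) _))
    by_contra! hθ'
    simp only [mem_union, mem_ofPred_eq, not_or, not_lt] at hθ'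
    obtain ⟨⟨h4, h5⟩, h6⟩ := hθ'
    have h7 := birkhoffAvg_blockSeq_le (U := U) (m := m) (iterate_randomPoint θ)
      (fun d hd => hm d (by simpa [windowDigit, h5] using hd))
      (fun d hd => hm d (by simpa [windowDigit, h6] using hd)) h1 h2
    refine (h7.trans (le_trans ?_ h3)).not_gt hθ
    refine div_le_div_of_nonneg_right ?_ (by positivity)
    have : (randomIndex θ).unpair.1 ≤ j := (Nat.unpair_left_le _).trans h4
    have : ((randomIndex θ).unpair.1 : ℝ) ≤ j := by exact_mod_cast this
    linarith
  tendsto_avg U hU hU0 hU1 θ := by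
    obtain ⟨m₀, hm₀⟩ := exists_forall_agree_mem (hU.preimage continuous_sinCode)
      (s := fun _ => 0) (by simpa [sinCode_zero] using hU0)
    obtain ⟨m₁, hm₁⟩ := exists_forall_agree_mem (hU.preimage continuous_sinCode)
      (s := fun _ => 1) (by simpa [sinCode_one] using hU1)
    have hm : ∀ j d, (∀ i < max m₀ m₁, d i = windowDigit θ j) → sinCode d ∈ U := by
      intro j d hd
      by_cases h : θ ∈ sweepingWindow j
      · exact hm₁ d fun i hi => by
          simpa [windowDigit, h] using hd i (lt_max_of_lt_right hi)
      · exact hm₀ d fun i hi => by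
          simpa [windowDigit, h] using hd i (lt_max_of_lt_left hi)
    refine Metric.tendsto_nhds.mpr fun ε hε => ?_
    filter_upwards [eventually_exists_block
      (C := (randomIndex θ).unpair.1 + 2 * (max m₀ m₁ : ℕ) + 1) (half_pos hε)] with n hn
    obtain ⟨j, -, h1, h2, h3⟩ := hn
    have h7 := birkhoffAvg_blockSeq_le (iterate_randomPoint θ) (hm j) (hm (j + 1)) h1 h2
    rw [dist_zero_right, Real.norm_of_nonneg (birkhoffAvg_nonneg _ _ _ _)]
    refine (h7.trans (le_trans ?_ h3)).trans_lt (half_lt_self hε)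
    gcongr
    norm_num
  frequently_zero U hU hU0 θ := by
    refine frequently_birkhoffAvg_blockSeq (iterate_randomPoint θ) hU (a := 0)
      (by rwa [sinCode_zero]) ((frequently_notMem_sweepingWindow θ).mono fun j hj => ?_)
    simp [windowDigit, hj]
  frequently_one U hU hU1 θ := by
    refine frequently_birkhoffAvg_blockSeq (iterate_randomPoint θ) hU (a := 1)
      (by rwa [sinCode_one]) ((frequently_mem_sweepingWindow θ).mono fun j hj => ?_)
    simp [windowDigit, hj]
  frequently_mem U hU hne θ := frequently_iterate_blockSeq_mem (iterate_randomPoint θ) hU hne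

/-- there is a continuous interval map with
`A_phys(f) = {0} ⊊ A_stat(f) = {0,1} ⊊ Λ(f) = [0,1]`. -/
theorem stmt10 :
    ∃ f : C(I01, I01),
      physAttr (volume : Measure I01) ⇑f = {(0 : I01)} ∧
      statAttr (volume : Measure I01) ⇑f = {(0 : I01), (1 : I01)} ∧
      milnorAttr (volume : Measure I01) ⇑f = univ ∧
      physAttr (volume : Measure I01) ⇑f ⊂ statAttr (volume : Measure I01) ⇑f ∧
      statAttr (volume : Measure I01) ⇑f ⊂ milnorAttr (volume : Measure I01) ⇑f := by
  have hx := alternatingOrbits_randomPoint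
  let μ : Measure I01 := volume.map randomPoint
  have : IsProbabilityMeasure μ := Measure.isProbabilityMeasure_map hx.measurable.aemeasurable
  have : μ.IsOpenPosMeasure := ⟨fun U hU hne => by
    rw [Measure.map_apply hx.measurable hU.measurableSet]
    exact (measure_preimage_randomPoint_pos hU hne).ne'⟩
  have : NullSingletonClass μ := ⟨fun p => by
    rw [Measure.map_apply hx.measurable (measurableSet_singleton p)]
    exact hx.measure_fiber p⟩
  obtain ⟨h, h0, h1, hmap⟩ := exists_homeomorph_map_eq_volume μ
  let g : C(I01, I01) := ⟨h ∘ sinTripling ∘ h.symm, by fun_prop⟩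
  have hy : AlternatingOrbits g (h ∘ randomPoint) :=
    hx.semiconj h (fun z => by simp [g]) h0 h1
  have hmp : MeasurePreserving (h ∘ randomPoint) volume volume :=
    ⟨hy.measurable, by rw [← Measure.map_map h.continuous.measurable hx.measurable]; exact hmap⟩
  have hphys := hy.physAttr_eq g.continuous hmp
  have hstat := hy.statAttr_eq g.continuous hmp
  have hmilnor := hy.milnorAttr_eq hmp
  refine ⟨g, hphys, hstat, hmilnor, ?_, ?_⟩
  · rw [hphys, hstat]
    refine ⟨by simp, fun h => ?_⟩
    exact one_ne_zero (h (Or.inr rfl : (1 : I01) ∈ ({0, 1} : Set I01)))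
  · rw [hstat, hmilnor]
    refine ⟨subset_univ _, fun h => ?_⟩
    have h2 : (⟨1/2, by norm_num, by norm_num⟩ : I01) ∈ ({0, 1} : Set I01) := h (mem_univ _)
    rcases h2 with h2 | h2
    · have := congrArg Subtype.val h2
      norm_num at this
    · have := congrArg Subtype.val h2
      norm_num at this
end
end
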